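/- arXiv:math/0601225 — 2 statements merged into one kernel-verified Lean document; each statement's English description precedes it below -/
import Mathlib

section
/- Let X_6 be the blow-up of the complex projective plane at 6 distinct points x_1, …, x_6 in general position, and let x be a point of X_6 in general position. Then the Seshadri constant of the anticanonical divisor −K_{X_6} at x equals 3/2. -/
open MvPolynomial

noncomputable section

/-- The complex projective plane `ℙ²`, as the projectivization of `ℂ³`. -/
abbrev P2 : Type := Projectivization ℂ (Fin 3 → ℂ)

/-- The iterated partial derivative `∂₀^(k 0) ∂₁^(k 1) ∂₂^(k 2) F` of a polynomial in three
variables. -/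
def iterDeriv (k : Fin 3 → ℕ) (F : MvPolynomial (Fin 3) ℂ) : MvPolynomial (Fin 3) ℂ :=
  (fun G => pderiv (0 : Fin 3) G)^[k 0] <|
    (fun G => pderiv (1 : Fin 3) G)^[k 1] <|
      (fun G => pderiv (2 : Fin 3) G)^[k 2] F

/-- `F` vanishes to order at least `m` at the vector `v` : all partial derivatives of total
order `< m` vanish at `v`.  (For `F` homogeneous this is invariant under scaling of `v`, and
for `v ≠ 0` it is the multiplicity condition at the corresponding projective point.) -/
def HasMultGE (F : MvPolynomial (Fin 3) ℂ) (v : Fin 3 → ℂ) (m : ℕ) : Prop :=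
  ∀ k : Fin 3 → ℕ, k 0 + k 1 + k 2 < m → eval v (iterDeriv k F) = 0

/-- `F` vanishes to order at least `m` at the projective point `p`. -/
def pHasMultGE (F : MvPolynomial (Fin 3) ℂ) (p : P2) (m : ℕ) : Prop :=
  HasMultGE F p.rep m

/-- The multiplicity of the plane curve `{F = 0}` at the projective point `p`
(the largest `m` such that all partials of order `< m` vanish at `p`). -/
def pMult (F : MvPolynomial (Fin 3) ℂ) (p : P2) : ℕ :=
  sSup {m : ℕ | pHasMultGE F p m}

/-- The plane curve `{F = 0}` passes through the projective point `p`. -/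
def pVanish (F : MvPolynomial (Fin 3) ℂ) (p : P2) : Prop :=
  eval p.rep F = 0

/-- The plane curve `{F = 0}` is smooth (every point of it is a nonsingular point). -/
def SmoothPlaneCurve (F : MvPolynomial (Fin 3) ℂ) : Prop :=
  ∀ p : P2, pVanish F p → ∃ i : Fin 3, eval p.rep (pderiv i F) ≠ 0

/-- `p` is a singular point of the plane curve `{F = 0}`. -/
def SingularAt (F : MvPolynomial (Fin 3) ℂ) (p : P2) : Prop :=
  pVanish F p ∧ ∀ i : Fin 3, eval p.rep (pderiv i F) = 0

/-- A tuple of points of `ℙ²` is in general position if the points are pairwise distinct,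
no `3` of them lie on a line, no `6` of them lie on a conic, and no `8` of them lie on a
cubic which is singular at one of them. -/
def GenPos {n : ℕ} (p : Fin n → P2) : Prop :=
  Function.Injective p ∧
  (∀ f : Fin 3 ↪ Fin n, ¬ ∃ L : MvPolynomial (Fin 3) ℂ,
      L ≠ 0 ∧ L.IsHomogeneous 1 ∧ ∀ k, pVanish L (p (f k))) ∧
  (∀ f : Fin 6 ↪ Fin n, ¬ ∃ Q : MvPolynomial (Fin 3) ℂ,
      Q ≠ 0 ∧ Q.IsHomogeneous 2 ∧ ∀ k, pVanish Q (p (f k))) ∧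
  (∀ f : Fin 8 ↪ Fin n, ¬ ∃ F : MvPolynomial (Fin 3) ℂ,
      F ≠ 0 ∧ F.IsHomogeneous 3 ∧ (∀ k, pVanish F (p (f k))) ∧ ∃ k, pHasMultGE F (p (f k)) 2)

/-- The irreducible plane curve `{F = 0}` is rational: it admits a nonconstant parametrization
by `ℙ¹`, given by a triple of homogeneous polynomials of the same degree in two variables. -/
def RatPlaneCurve (F : MvPolynomial (Fin 3) ℂ) : Prop :=
  ∃ (φ : Fin 3 → MvPolynomial (Fin 2) ℂ) (e : ℕ),
    (∀ j, (φ j).IsHomogeneous e) ∧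
    (∃ s t : Fin 2 → ℂ, ∀ c : ℂ,
      (fun j => eval s (φ j)) ≠ c • fun j => eval t (φ j)) ∧
    aeval φ F = 0

/-- Data of the blow-up `X` of `ℙ²` at the `r` distinct points `pts`, together with its theory
of (irreducible, reduced) curves:  `mem x C` says that `x` lies on the curve `C`, `mult x C`
is the multiplicity of `C` at `x`, the class of a curve `C` in `Pic X = ℤH ⊕ ⨁ᵢ ℤEᵢ` is
`degH C · H - ∑ i, multE C i · Eᵢ`, `interK C` is the intersection number `(-K_X)·C`
(so `interK C = 3 degH C - ∑ i multE C i`), `rational C` (resp. `nodal C`) says that `C` is a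
rational (resp. nodal) curve, and `Eexc i` is the exceptional curve over `pts i`.
Away from the blown-up points, the blow-up map `μ` is a bijection, and the non-exceptional
curves are exactly the strict transforms of the irreducible plane curves, with the
corresponding classes and multiplicities. -/
structure BlowupP2 (r : ℕ) (pts : Fin r → P2) where
  X : Type
  μ : X → P2
  μ_surj : Function.Surjective μ
  μ_unique : ∀ q : P2, q ∉ Set.range pts → ∃! x : X, μ x = q
  Curve : Type
  mem : X → Curve → Prop
  mult : X → Curve → ℕ
  mult_pos_iff : ∀ (x : X) (C : Curve), 0 < mult x C ↔ mem x C
  degH : Curve → ℕ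
  multE : Curve → Fin r → ℤ
  interK : Curve → ℤ
  interK_eq : ∀ C : Curve, interK C = 3 * (degH C : ℤ) - ∑ i, multE C i
  rational : Curve → Prop
  nodal : Curve → Prop
  nodal_mult : ∀ C : Curve, nodal C → ∀ x : X, mult x C ≤ 2
  Eexc : Fin r → Curve
  mem_exc : ∀ (i : Fin r) (x : X), mem x (Eexc i) ↔ μ x = pts i
  exc_degH : ∀ i, degH (Eexc i) = 0
  exc_multE_self : ∀ i, multE (Eexc i) i = -1
  exc_multE_ne : ∀ i j, i ≠ j → multE (Eexc i) j = 0
  exc_rational : ∀ i, rational (Eexc i)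
  strict_exists : ∀ (d : ℕ) (F : MvPolynomial (Fin 3) ℂ),
    F.IsHomogeneous d → Irreducible F →
    ∃ C : Curve, degH C = d ∧ (∀ i, multE C i = (pMult F (pts i) : ℤ)) ∧
      (∀ x : X, μ x ∉ Set.range pts →
        ((mem x C ↔ pVanish F (μ x)) ∧ mult x C = pMult F (μ x))) ∧
      (rational C ↔ RatPlaneCurve F)
  curve_cases : ∀ C : Curve, (∃ i, C = Eexc i) ∨
    ∃ (d : ℕ) (F : MvPolynomial (Fin 3) ℂ),
      F.IsHomogeneous d ∧ Irreducible F ∧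
      degH C = d ∧ (∀ i, multE C i = (pMult F (pts i) : ℤ)) ∧
      (∀ x : X, μ x ∉ Set.range pts →
        ((mem x C ↔ pVanish F (μ x)) ∧ mult x C = pMult F (μ x))) ∧
      (rational C ↔ RatPlaneCurve F)

namespace BlowupP2

variable {r : ℕ} {pts : Fin r → P2}

/-- The Seshadri constant of the anticanonical divisor `-K_X` at a point `x` of the blow-up:
the infimum over all irreducible curves `C` through `x` of `((-K_X)·C) / mult_x C`. -/
def seshadri (B : BlowupP2 r pts) (x : B.X) : ℝ :=
  sInf {t : ℝ | ∃ C : B.Curve, B.mem x C ∧ t = (B.interK C : ℝ) / (B.mult x C : ℝ)}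

/-- A point `x` of the blow-up of `ℙ²` at `pts` is in general position if its image `μ x` is
distinct from the blown-up points and the points `pts` together with `μ x` are in general
position. -/
def genPosPt (B : BlowupP2 r pts) (x : B.X) : Prop :=
  B.μ x ∉ Set.range pts ∧ GenPos (Fin.snoc pts (B.μ x))

end BlowupP2

/-- The zero locus in `(ℙ²)^r` of a polynomial in the coordinates of the `r` points. -/
def projZeroSet {r : ℕ} (f : MvPolynomial (Fin r × Fin 3) ℂ) : Set (Fin r → P2) :=
  {p | eval (fun q => (p q.1).rep q.2) f = 0}

/-- The vanishing of `f` at a tuple of nonzero vectors only depends on the corresponding tuple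
of projective points (so that `projZeroSet f` is a well-defined closed subvariety of
`(ℙ²)^r`). -/
def GoodFamilyPoly (r : ℕ) (f : MvPolynomial (Fin r × Fin 3) ℂ) : Prop :=
  ∀ v w : Fin r → Fin 3 → ℂ,
    (∀ i, ∃ c : ℂ, c ≠ 0 ∧ w i = c • v i) →
    (eval (fun q => v q.1 q.2) f = 0 → eval (fun q => w q.1 q.2) f = 0)

/-- `P` holds for every tuple of `r` points of `ℙ²` in very general position: there is a
countable family of proper closed hypersurfaces of `(ℙ²)^r` such that `P p` holds for every
tuple `p` avoiding all of them. -/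
def VeryGeneralHolds (r : ℕ) (P : (Fin r → P2) → Prop) : Prop :=
  ∃ bad : ℕ → MvPolynomial (Fin r × Fin 3) ℂ,
    (∀ n, GoodFamilyPoly r (bad n)) ∧
    (∀ n, projZeroSet (bad n) ≠ Set.univ) ∧
    ∀ p : Fin r → P2, (∀ n, p ∉ projZeroSet (bad n)) → P p

theorem pderiv_comm' (i j : Fin 3) (G : MvPolynomial (Fin 3) ℂ) :
    pderiv i (pderiv j G) = pderiv j (pderiv i G) := by
  have h : ⁅(pderiv i : Derivation ℂ (MvPolynomial (Fin 3) ℂ) (MvPolynomial (Fin 3) ℂ)),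
      (pderiv j : Derivation ℂ (MvPolynomial (Fin 3) ℂ) (MvPolynomial (Fin 3) ℂ))⁆ = 0 := by
    apply MvPolynomial.derivation_ext
    intro k
    rw [Derivation.commutator_apply]
    simp only [pderiv_X, Pi.single_apply]
    split_ifs <;> simp
  have h2 := congrArg (fun D => D G) h
  simp only [Derivation.commutator_apply, Derivation.coe_zero, Pi.zero_apply] at h2
  exact sub_eq_zero.mp h2

theorem iterDeriv_pderiv (k : Fin 3 → ℕ) (i : Fin 3) (G : MvPolynomial (Fin 3) ℂ) :
    iterDeriv k (pderiv i G) = iterDeriv (k + Pi.single i 1) G := by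
  have hc : ∀ (j : Fin 3) (n : ℕ) (H : MvPolynomial (Fin 3) ℂ),
      (fun G => pderiv j G)^[n] (pderiv i H) = pderiv i ((fun G => pderiv j G)^[n] H) := by
    intro j n
    induction n with
    | zero => intro H; rfl
    | succ n ih =>
      intro H
      rw [Function.iterate_succ_apply, Function.iterate_succ_apply]
      rw [pderiv_comm' j i, ih]
  fin_cases i
  · simp [iterDeriv] at hc ⊢
    rw [hc, hc, ← Function.iterate_succ_apply]
  · simp [iterDeriv] at hc ⊢
    rw [hc, ← Function.iterate_succ_apply]
  · simp [iterDeriv] at hc ⊢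

theorem HasMultGE.pderiv {G : MvPolynomial (Fin 3) ℂ} {v : Fin 3 → ℂ} {m : ℕ}
    (h : HasMultGE G v (m + 1)) (i : Fin 3) : HasMultGE (pderiv i G) v m := by
  intro k hk
  rw [iterDeriv_pderiv]
  apply h
  fin_cases i <;> simp <;> omega

theorem HasMultGE.eval_zero {G : MvPolynomial (Fin 3) ℂ} {v : Fin 3 → ℂ} {m : ℕ}
    (h : HasMultGE G v m) (hm : 0 < m) : eval v G = 0 := by
  simpa [iterDeriv] using h (fun _ => 0) (by simpa using hm)

theorem HasMultGE.eval_pderiv {G : MvPolynomial (Fin 3) ℂ} {v : Fin 3 → ℂ} {m : ℕ}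
    (h : HasMultGE G v m) (hm : 2 ≤ m) (i : Fin 3) : eval v (MvPolynomial.pderiv i G) = 0 := by
  obtain ⟨n, rfl⟩ : ∃ n, m = n + 1 := ⟨m - 1, by omega⟩
  exact (h.pderiv i).eval_zero (by omega)

theorem aeval_mul_hom {R : Type*} [CommRing R] [Algebra ℂ R] {G : MvPolynomial (Fin 3) ℂ} {d : ℕ}
    (hG : G.IsHomogeneous d) (c : R) (f : Fin 3 → R) :
    aeval (fun j => c * f j) G = c ^ d * aeval f G := by
  rw [aeval_def, aeval_def, eval₂_eq', eval₂_eq', Finset.mul_sum]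
  refine Finset.sum_congr rfl fun s hs => ?_
  have := hG.degree_eq_sum_deg_support hs
  have h2 : ∏ i, c ^ s i = c ^ d := by
    rw [Finset.prod_pow_eq_pow_sum, this]
    congr 1
    symm
    apply Finset.sum_subset (Finset.subset_univ _)
    intro x _ hx
    simpa using hx
  simp only [mul_pow, Finset.prod_mul_distrib, h2]
  ring

theorem eval_smul_hom {G : MvPolynomial (Fin 3) ℂ} {d : ℕ}
    (hG : G.IsHomogeneous d) (c : ℂ) (f : Fin 3 → ℂ) :
    eval (c • f) G = c ^ d * eval f G := by
  have := aeval_mul_hom hG c f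
  have e : c • f = fun j => c * f j := rfl
  rw [e]
  simpa [coe_aeval_eq_eval] using this

theorem eval_aeval_poly (G : MvPolynomial (Fin 3) ℂ) (φ : Fin 3 → Polynomial ℂ) (r : ℂ) :
    Polynomial.eval r (aeval φ G) = eval (fun j => Polynomial.eval r (φ j)) G := by
  have : (Polynomial.aeval r).comp (aeval φ) = (aeval (fun j => Polynomial.eval r (φ j)) : MvPolynomial (Fin 3) ℂ →ₐ[ℂ] ℂ) := by
    apply MvPolynomial.algHom_ext
    intro i
    simp
  have := congrArg (fun f => f G) this
  simpa [coe_aeval_eq_eval] using this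

theorem derivative_aeval_mv (G : MvPolynomial (Fin 3) ℂ) (φ : Fin 3 → Polynomial ℂ) :
    Polynomial.derivative (aeval φ G) =
      ∑ j, aeval φ (pderiv j G) * Polynomial.derivative (φ j) := by
  induction G using MvPolynomial.induction_on with
  | C a => simp
  | add p q hp hq => simp [hp, hq, add_mul, Finset.sum_add_distrib]
  | mul_X p i hp =>
    have e : ∀ j, aeval φ (pderiv j (p * X i)) * Polynomial.derivative (φ j) =
        aeval φ (pderiv j p) * Polynomial.derivative (φ j) * φ i +
          (if i = j then aeval φ p * Polynomial.derivative (φ j) else 0) := by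
      intro j
      rw [pderiv_mul, pderiv_X, map_add, map_mul, map_mul, aeval_X]
      by_cases h : i = j
      · subst h; simp; ring
      · simp [h]; ring
    rw [Finset.sum_congr rfl fun j _ => e j, Finset.sum_add_distrib, ← Finset.sum_mul, ← hp,
      Finset.sum_ite_eq, if_pos (Finset.mem_univ i), map_mul, aeval_X, Polynomial.derivative_mul]

theorem dvd_of_hasMult (r : ℂ) (φ : Fin 3 → Polynomial ℂ) (v : Fin 3 → ℂ) (c : ℂ)
    (hφ : ∀ j, Polynomial.eval r (φ j) = c * v j) :
    ∀ (m : ℕ) (G : MvPolynomial (Fin 3) ℂ) (d : ℕ), G.IsHomogeneous d → HasMultGE G v m →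
      (Polynomial.X - Polynomial.C r) ^ m ∣ aeval φ G := by
  intro m
  induction m with
  | zero => intro G d _ _; simp
  | succ m ih =>
    intro G d hG hm
    by_cases h0 : aeval φ G = 0
    · rw [h0]; exact dvd_zero _
    have hr : Polynomial.IsRoot (aeval φ G) r := by
      rw [Polynomial.IsRoot, eval_aeval_poly]
      have : (fun j => Polynomial.eval r (φ j)) = c • v := by ext j; simp [hφ]
      rw [this, eval_smul_hom hG, hm.eval_zero (by omega), mul_zero]
    have hd : (Polynomial.X - Polynomial.C r) ^ m ∣ Polynomial.derivative (aeval φ G) := by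
      rw [derivative_aeval_mv]
      exact Finset.dvd_sum fun j _ => Dvd.dvd.mul_right (ih _ _ hG.pderiv (hm.pderiv j)) _
    have hpos := (Polynomial.rootMultiplicity_pos h0).2 hr
    rw [← Polynomial.le_rootMultiplicity_iff h0]
    have h1 := Polynomial.derivative_rootMultiplicity_of_root hr
    have hd0 : Polynomial.derivative (aeval φ G) ≠ 0 := by
      intro hz
      have := Polynomial.derivative_eq_zero.1 hz
      rw [Polynomial.natDegree_eq_zero] at this
      obtain ⟨x, hx⟩ := this
      rw [← hx] at hr h0
      simp at hr h0
      exact h0 hr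
    have h2 := (Polynomial.le_rootMultiplicity_iff hd0).2 hd
    omega

theorem natDegree_aeval_le {G : MvPolynomial (Fin 3) ℂ} {d : ℕ} (hG : G.IsHomogeneous d)
    (φ : Fin 3 → Polynomial ℂ) (e : ℕ) (he : ∀ j, (φ j).natDegree ≤ e) :
    (aeval φ G).natDegree ≤ e * d := by
  have := MvPolynomial.aeval_natDegree_le G hG.totalDegree_le φ he
  rwa [mul_comm] at this

theorem eq_zero_of_mult {G : MvPolynomial (Fin 3) ℂ} {d : ℕ} (hG : G.IsHomogeneous d)
    {v : Fin 3 → ℂ} {m : ℕ} (h : HasMultGE G v m) (hm : d < m) : G = 0 := by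
  apply MvPolynomial.funext
  intro w
  set φ : Fin 3 → Polynomial ℂ := fun j =>
    Polynomial.C (v j) + Polynomial.X * Polynomial.C (w j - v j) with hφ
  have h1 := dvd_of_hasMult 0 φ v 1 (by intro j; simp [hφ]) m G d hG h
  have h2 := natDegree_aeval_le hG φ 1 (by intro j; simp only [hφ]; compute_degree)
  have h3 : aeval φ G = 0 := by
    by_contra h0
    have := Polynomial.natDegree_le_of_dvd h1 h0
    rw [Polynomial.natDegree_pow, Polynomial.natDegree_X_sub_C] at this
    omega
  have h4 := eval_aeval_poly G φ 1
  rw [h3] at h4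
  have : (fun j => Polynomial.eval 1 (φ j)) = w := by ext j; simp [hφ]
  rw [this] at h4
  simpa using h4.symm

theorem pMult_spec {G : MvPolynomial (Fin 3) ℂ} {d : ℕ} (hG : G.IsHomogeneous d) (h0 : G ≠ 0)
    (p : P2) : HasMultGE G p.rep (pMult G p) := by
  have hb : BddAbove {m : ℕ | pHasMultGE G p m} := by
    refine ⟨d, fun m hm => ?_⟩
    by_contra hlt
    exact h0 (eq_zero_of_mult hG hm (by omega))
  exact Nat.sSup_mem ⟨0, fun k hk => by omega⟩ hb

theorem le_pMult {G : MvPolynomial (Fin 3) ℂ} {d : ℕ} (hG : G.IsHomogeneous d) (h0 : G ≠ 0)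
    (p : P2) {m : ℕ} (hm : HasMultGE G p.rep m) : m ≤ pMult G p := by
  have hb : BddAbove {m : ℕ | pHasMultGE G p m} := by
    refine ⟨d, fun m hm => ?_⟩
    by_contra hlt
    exact h0 (eq_zero_of_mult hG hm (by omega))
  exact le_csSup hb hm

/-- Determinant of three vectors. -/
def d3 (u v w : Fin 3 → ℂ) : ℂ :=
  u 0 * (v 1 * w 2 - v 2 * w 1) - u 1 * (v 0 * w 2 - v 2 * w 0) + u 2 * (v 0 * w 1 - v 1 * w 0)

/-- The linear form with given coefficients. -/
def linF (n : Fin 3 → ℂ) : MvPolynomial (Fin 3) ℂ := ∑ j, C (n j) * X j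

theorem linF_hom (n : Fin 3 → ℂ) : (linF n).IsHomogeneous 1 :=
  IsHomogeneous.sum _ _ _ fun _ _ => isHomogeneous_C_mul_X _ _

theorem eval_linF (n v : Fin 3 → ℂ) : eval v (linF n) = n 0 * v 0 + n 1 * v 1 + n 2 * v 2 := by
  simp [linF, Fin.sum_univ_three]

theorem cramer (a b c w : Fin 3 → ℂ) (j : Fin 3) :
    d3 a b c * w j = d3 w b c * a j + d3 a w c * b j + d3 a b w * c j := by
  fin_cases j <;> simp [d3] <;> ring

theorem d3_ne_zero (u v w : Fin 3 → ℂ)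
    (h : ¬ ∃ L : MvPolynomial (Fin 3) ℂ, L ≠ 0 ∧ L.IsHomogeneous 1 ∧
      eval u L = 0 ∧ eval v L = 0 ∧ eval w L = 0) : d3 u v w ≠ 0 := by
  intro hd
  have hdet : (Matrix.of ![u, v, w]).det = 0 := by
    rw [Matrix.det_fin_three, ← hd]
    simp [d3]; ring
  obtain ⟨n, hn, hn0⟩ := Matrix.exists_mulVec_eq_zero_iff.2 hdet
  have e0 := congrFun hn0 0
  have e1 := congrFun hn0 1
  have e2 := congrFun hn0 2
  simp [Matrix.mulVec, dotProduct, Fin.sum_univ_three] at e0 e1 e2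
  refine h ⟨linF n, ?_, linF_hom n, ?_, ?_, ?_⟩
  · intro h0
    apply hn
    ext j
    have := eval_linF n (Pi.single j 1)
    rw [h0] at this
    fin_cases j <;> simpa using this.symm
  · rw [eval_linF]; linear_combination e0
  · rw [eval_linF]; linear_combination e1
  · rw [eval_linF]; linear_combination e2

theorem euler_eval {G : MvPolynomial (Fin 3) ℂ} {d : ℕ} (hG : G.IsHomogeneous d)
    (v : Fin 3 → ℂ) : (d : ℂ) * eval v G = v 0 * eval v (pderiv 0 G) + v 1 * eval v (pderiv 1 G)
      + v 2 * eval v (pderiv 2 G) := by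
  have := congrArg (eval v) hG.sum_X_mul_pderiv
  simp [Fin.sum_univ_three] at this
  exact this.symm

theorem conic_form {G : MvPolynomial (Fin 3) ℂ} (hG : G.IsHomogeneous 2) :
    ∃ s : Fin 3 → Fin 3 → ℂ, (∀ i j, s i j = s j i) ∧
      (∀ v i, eval v (pderiv i G) = s i 0 * v 0 + s i 1 * v 1 + s i 2 * v 2) := by
  have hc : ∀ i j, ∃ c, pderiv j (pderiv i G) = C c := by
    intro i j
    have h : (pderiv j (pderiv i G)).IsHomogeneous 0 := hG.pderiv.pderiv
    rw [← totalDegree_zero_iff_isHomogeneous, totalDegree_eq_zero_iff_eq_C] at h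
    exact ⟨_, h⟩
  choose s hs using hc
  refine ⟨s, ?_, ?_⟩
  · intro i j
    have := pderiv_comm' j i G
    rw [hs, hs] at this
    exact C_injective _ _ this
  · intro v i
    have := euler_eval (G := pderiv i G) (d := 1) hG.pderiv v
    simp only [hs, eval_C] at this
    push_cast at this
    linear_combination this

theorem conic_lemma {G : MvPolynomial (Fin 3) ℂ} (hG : G.IsHomogeneous 2)
    (v a b c : Fin 3 → ℂ) (hv : ∀ i, eval v (pderiv i G) = 0)
    (ha : eval a G = 0) (hb : eval b G = 0) (hc : eval c G = 0)
    (h1 : d3 v a b ≠ 0) (h2 : d3 v c b ≠ 0) (h3 : d3 v a c ≠ 0) : G = 0 := by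
  obtain ⟨s, hs, hd⟩ := conic_form hG
  have hq : ∀ w, 2 * eval w G = w 0 * (s 0 0 * w 0 + s 0 1 * w 1 + s 0 2 * w 2)
      + w 1 * (s 1 0 * w 0 + s 1 1 * w 1 + s 1 2 * w 2)
      + w 2 * (s 2 0 * w 0 + s 2 1 * w 1 + s 2 2 * w 2) := by
    intro w
    have := euler_eval hG w
    simp only [hd] at this
    exact_mod_cast this
  have s10 := hs 1 0
  have s20 := hs 2 0
  have s21 := hs 2 1
  have hv0 := hv 0
  have hv1 := hv 1
  have hv2 := hv 2
  rw [hd] at hv0 hv1 hv2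
  have qa := hq a
  have qb := hq b
  have qc := hq c
  rw [ha] at qa
  rw [hb] at qb
  rw [hc] at qc
  rw [s10, s20, s21] at *
  set B : ℂ := a 0 * (s 0 0 * b 0 + s 0 1 * b 1 + s 0 2 * b 2)
      + a 1 * (s 0 1 * b 0 + s 1 1 * b 1 + s 1 2 * b 2)
      + a 2 * (s 0 2 * b 0 + s 1 2 * b 1 + s 2 2 * b 2) with hB
  have key : ∀ w : Fin 3 → ℂ, (d3 v a b) ^ 2 * (2 * eval w G) = 2 * d3 v w b * d3 v a w * B := by
    intro w
    have e : ∀ (x y z : ℂ) , 2 * eval (fun j => x * v j + y * a j + z * b j) G = 2 * y * z * B := by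
      intro x y z
      rw [hq, hs 1 0, hs 2 0, hs 2 1]
      simp only [hB]
      linear_combination (x * (x * v 0 + 2 * y * a 0 + 2 * z * b 0)) * hv0 +
        (x * (x * v 1 + 2 * y * a 1 + 2 * z * b 1)) * hv1 +
        (x * (x * v 2 + 2 * y * a 2 + 2 * z * b 2)) * hv2 - y ^ 2 * qa - z ^ 2 * qb
    have h := e (d3 w a b) (d3 v w b) (d3 v a w)
    have e2 : (fun j => d3 w a b * v j + d3 v w b * a j + d3 v a w * b j) = d3 v a b • w := by
      ext j
      rw [← cramer]; rfl
    rw [e2, eval_smul_hom hG] at h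
    linear_combination h
  have hB0 : B = 0 := by
    have := key c
    rw [hc] at this
    simp at this
    simpa [h2, h3] using this
  apply MvPolynomial.funext
  intro w
  have := key w
  rw [hB0] at this
  simpa [h1] using this

theorem top_factor {A B F : MvPolynomial (Fin 3) ℂ} {d : ℕ} (hF : F.IsHomogeneous d) (h0 : F ≠ 0)
    (h : F = A * B) : A.totalDegree + B.totalDegree = d ∧
      F = homogeneousComponent A.totalDegree A * homogeneousComponent B.totalDegree B := by
  have hA : A ≠ 0 := by rintro rfl; simp at h; exact h0 h
  have hB : B ≠ 0 := by rintro rfl; simp at h; exact h0 h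
  have hdeg : A.totalDegree + B.totalDegree = d := by
    rw [← totalDegree_mul_of_isDomain hA hB, ← h, hF.totalDegree h0]
  refine ⟨hdeg, ?_⟩
  have h1 : homogeneousComponent d (A * B) = F := by
    rw [← h]; exact homogeneousComponent_eq_self hF
  rw [← h1]
  conv_lhs => rw [← sum_homogeneousComponent A, ← sum_homogeneousComponent B, Finset.sum_mul_sum]
  rw [map_sum]
  simp only [map_sum]
  have e : ∀ i j, homogeneousComponent d (homogeneousComponent i A * homogeneousComponent j B) =
      if i + j = d then homogeneousComponent i A * homogeneousComponent j B else 0 := by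
    intro i j
    have hm := (homogeneousComponent_isHomogeneous i A).mul (homogeneousComponent_isHomogeneous j B)
    rw [homogeneousComponent_of_mem ((mem_homogeneousSubmodule _ _).2 hm)]
    simp only [eq_comm]
  simp only [e]
  rw [Finset.sum_eq_single A.totalDegree, Finset.sum_eq_single B.totalDegree]
  · rw [if_pos hdeg]
  · intro j hj hne
    rw [if_neg (by omega)]
  · simp
  · intro i hi hne
    apply Finset.sum_eq_zero
    intro j hj
    rw [Finset.mem_range] at hi hj
    rw [if_neg (by omega)]
  · simp

theorem iterDeriv_hom {G : MvPolynomial (Fin 3) ℂ} {d : ℕ} (hG : G.IsHomogeneous d)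
    (k : Fin 3 → ℕ) : ∃ n, (iterDeriv k G).IsHomogeneous n := by
  have hc : ∀ (j : Fin 3) (n : ℕ) (H : MvPolynomial (Fin 3) ℂ), (∃ e, H.IsHomogeneous e) →
      ∃ e, ((fun G => pderiv j G)^[n] H).IsHomogeneous e := by
    intro j n
    induction n with
    | zero => intro H h; exact h
    | succ n ih =>
      rintro H ⟨e, h⟩
      rw [Function.iterate_succ_apply]
      exact ih _ ⟨_, h.pderiv⟩
  exact hc _ _ _ (hc _ _ _ (hc _ _ _ ⟨d, hG⟩))

theorem HasMultGE.smul {G : MvPolynomial (Fin 3) ℂ} {d : ℕ} (hG : G.IsHomogeneous d)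
    {v : Fin 3 → ℂ} {m : ℕ} (h : HasMultGE G v m) (c : ℂ) : HasMultGE G (c • v) m := by
  intro k hk
  obtain ⟨n, hn⟩ := iterDeriv_hom hG k
  rw [eval_smul_hom hn, h k hk, mul_zero]

/-- Parametrization of the conic through the five normalized points. -/
def cpar (e1 e2 e3 : Fin 3 → ℂ) (c1 c2 c3 κ : ℂ) (j : Fin 3) : Polynomial ℂ :=
  Polynomial.C (e1 j) * ((Polynomial.X - Polynomial.C 1) *
    (Polynomial.C c1 * (Polynomial.C κ * Polynomial.X) +
      Polynomial.C c2 * (Polynomial.X - Polynomial.C 1))) +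
  Polynomial.C (e2 j) * ((Polynomial.C κ * Polynomial.X) *
    (Polynomial.C c1 * (Polynomial.C κ * Polynomial.X) +
      Polynomial.C c2 * (Polynomial.X - Polynomial.C 1))) +
  Polynomial.C (e3 j) * (Polynomial.C (-c3) * (Polynomial.X - Polynomial.C 1) *
    (Polynomial.C κ * Polynomial.X))

theorem cpar_deg (e1 e2 e3 : Fin 3 → ℂ) (c1 c2 c3 κ : ℂ) (j : Fin 3) :
    (cpar e1 e2 e3 c1 c2 c3 κ j).natDegree ≤ 2 := by
  unfold cpar
  compute_degree

theorem cpar_eval (e1 e2 e3 : Fin 3 → ℂ) (c1 c2 c3 κ : ℂ) (j : Fin 3) (r : ℂ) :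
    Polynomial.eval r (cpar e1 e2 e3 c1 c2 c3 κ j) =
      e1 j * ((r - 1) * (c1 * (κ * r) + c2 * (r - 1))) +
      e2 j * ((κ * r) * (c1 * (κ * r) + c2 * (r - 1))) +
      e3 j * (-c3 * (r - 1) * (κ * r)) := by
  simp [cpar]

theorem sum_mult_le {G : MvPolynomial (Fin 3) ℂ} {d : ℕ} (hG : G.IsHomogeneous d)
    (φ : Fin 3 → Polynomial ℂ) (hφ : ∀ j, (φ j).natDegree ≤ 2) (h0 : aeval φ G ≠ 0)
    (v : Fin 5 → Fin 3 → ℂ) (m : Fin 5 → ℕ) (hm : ∀ i, HasMultGE G (v i) (m i))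
    (r : Fin 5 → ℂ) (hr : Function.Injective r)
    (s : Fin 5 → ℂ) (hs : ∀ i j, Polynomial.eval (r i) (φ j) = s i * v i j) :
    ∑ i, m i ≤ 2 * d := by
  have h1 : ∏ i, (Polynomial.X - Polynomial.C (r i)) ^ m i ∣ aeval φ G := by
    apply Finset.prod_dvd_of_coprime
    · intro i _ j _ hij
      exact (Polynomial.pairwise_coprime_X_sub_C hr hij).pow
    · intro i _
      exact dvd_of_hasMult (r i) φ (v i) (s i) (hs i) _ G d hG (hm i)
  have h2 := Polynomial.natDegree_le_of_dvd h1 h0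
  have h3 := natDegree_aeval_le hG φ 2 hφ
  rw [Polynomial.natDegree_prod_of_monic _ _
    (fun i _ => (Polynomial.monic_X_sub_C _).pow _)] at h2
  simp only [Polynomial.natDegree_pow, Polynomial.natDegree_X_sub_C, mul_one] at h2
  omega

/-- If `G` vanishes on the parametrized conic then `G` divides the equation of the conic. -/
theorem dvd_conic {G : MvPolynomial (Fin 3) ℂ} {d : ℕ} (hG : G.IsHomogeneous d)
    (hirr : Irreducible G) (e1 e2 e3 : Fin 3 → ℂ) (hD : d3 e1 e2 e3 ≠ 0)
    (c1 c2 c3 κ : ℂ) (hc : c1 + c2 + c3 = 0) (h3 : c3 ≠ 0) (hκ : κ ≠ 0)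
    (h0 : aeval (cpar e1 e2 e3 c1 c2 c3 κ) G = 0) : d ≤ 2 := by
  obtain ⟨x, y, z, hx, hy, hz, hxyz⟩ : ∃ x y z : Fin 3 → ℂ,
      (∀ w, eval w (linF x) = d3 w e2 e3) ∧ (∀ w, eval w (linF y) = d3 e1 w e3) ∧
      (∀ w, eval w (linF z) = d3 e1 e2 w) ∧
      (∀ j, C (d3 e1 e2 e3) * X j = linF x * C (e1 j) + linF y * C (e2 j) + linF z * C (e3 j)) := by
    let x : Fin 3 → ℂ := fun j => d3 (Pi.single j 1) e2 e3
    let y : Fin 3 → ℂ := fun j => d3 e1 (Pi.single j 1) e3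
    let z : Fin 3 → ℂ := fun j => d3 e1 e2 (Pi.single j 1)
    have hx : (∀ w, eval w (linF x) = d3 w e2 e3) := by
      intro w; rw [eval_linF]; simp [x, d3]; ring
    have hy : (∀ w, eval w (linF y) = d3 e1 w e3) := by
      intro w; rw [eval_linF]; simp [y, d3]; ring
    have hz : (∀ w, eval w (linF z) = d3 e1 e2 w) := by
      intro w; rw [eval_linF]; simp [z, d3]; ring
    refine ⟨x, y, z, hx, hy, hz, ?_⟩
    intro j
    apply MvPolynomial.funext
    intro w
    simp only [map_mul, map_add, eval_C, eval_X, hx, hy, hz]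
    exact cramer _ _ _ _ _
  set D := d3 e1 e2 e3 with hDdef
  set ℓ := C c1 * linF y + C c2 * linF x with hℓ
  set Q := C c1 * (linF y * linF z) + C c2 * (linF x * linF z) + C c3 * (linF x * linF y) with hQ
  set ψ : Fin 3 → MvPolynomial (Fin 3) ℂ := fun j =>
    linF x * ℓ * C (e1 j) + linF y * ℓ * C (e2 j) + (- C c3 * linF x * linF y) * C (e3 j) with hψ
  -- the form vanishes along psi
  have hψ0 : aeval ψ G = 0 := by
    set h := linF y - C κ * linF x with hh
    have hne : h ≠ 0 := by
      intro hz
      have := congrArg (eval e2) hz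
      rw [hh] at this
      simp only [map_sub, map_mul, hx, hy, eval_C, map_zero, ← hDdef] at this
      have h2 : d3 e2 e2 e3 = 0 := by simp [d3]; ring
      rw [h2] at this
      apply hD
      simpa using this
    have : h * aeval ψ G = 0 := by
      apply MvPolynomial.funext
      intro w
      rw [map_mul, map_zero]
      by_cases hw : eval w h = 0
      · rw [hw, zero_mul]
      have hev : eval w (aeval ψ G) = eval (fun j => eval w (ψ j)) G := by
        have : (aeval w : MvPolynomial (Fin 3) ℂ →ₐ[ℂ] ℂ).comp (aeval ψ) =
            (aeval (fun j => eval w (ψ j)) : MvPolynomial (Fin 3) ℂ →ₐ[ℂ] ℂ) := by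
          apply MvPolynomial.algHom_ext
          intro i
          simp
        have := congrArg (fun f => f G) this
        simpa [coe_aeval_eq_eval] using this
      rw [hev]
      have hw' : d3 e1 w e3 - κ * d3 w e2 e3 ≠ 0 := by
        simpa [hh, hx, hy] using hw
      set xx := d3 w e2 e3
      set yy := d3 e1 w e3
      set lam := (yy - κ * xx) / κ with hlam
      have hl0 : lam ≠ 0 := div_ne_zero hw' hκ
      set t := yy / (yy - κ * xx) with ht
      have ex : xx = lam * (t - 1) := by
        have h1 : t - 1 = κ * xx / (yy - κ * xx) := by
          rw [ht, div_sub_one hw']; congr 1; ring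
        rw [h1, hlam, div_mul_div_comm, eq_div_iff (mul_ne_zero hκ hw')]; ring
      have ey : yy = lam * (κ * t) := by
        rw [hlam, ht]; field_simp
      have e : (fun j => eval w (ψ j)) = lam ^ 2 • (fun j => Polynomial.eval t (cpar e1 e2 e3 c1 c2 c3 κ j)) := by
        ext j
        simp only [hψ, hℓ, map_add, map_mul, map_neg, eval_C, hx, hy, cpar_eval, Pi.smul_apply, smul_eq_mul]
        change xx * (c1 * yy + c2 * xx) * _ + yy * (c1 * yy + c2 * xx) * _ + (-c3 * xx * yy) * _ = _
        rw [ex, ey]; ring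
      rw [e, eval_smul_hom hG, ← eval_aeval_poly, h0]
      simp
    exact (mul_eq_zero.1 this).resolve_left hne
  have hdvd : Q ∣ (ℓ * C D) ^ d * G := by
    rw [← Ideal.mem_span_singleton, ← Ideal.Quotient.eq_zero_iff_mem]
    have e1' : (ℓ * C D) ^ d * G = aeval (fun j => (ℓ * C D) * X j) G := by
      rw [aeval_mul_hom hG]
      simp
    let π := Ideal.Quotient.mkₐ ℂ (Ideal.span {Q})
    have e2' : ∀ (f : Fin 3 → MvPolynomial (Fin 3) ℂ), π (aeval f G) = aeval (fun j => π (f j)) G := by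
      intro f
      have : π.comp (aeval f) = aeval (fun j => π (f j)) := by
        apply MvPolynomial.algHom_ext
        intro i
        simp
      exact congrArg (fun f => f G) this
    change π _ = 0
    rw [e1', e2']
    have e3' : (fun j => π ((ℓ * C D) * X j)) = fun j => π (ψ j) := by
      ext j
      rw [← sub_eq_zero, ← map_sub]
      change Ideal.Quotient.mk _ _ = 0
      rw [Ideal.Quotient.eq_zero_iff_mem, Ideal.mem_span_singleton]
      refine ⟨C (e3 j), ?_⟩
      rw [mul_assoc, hxyz j, hψ, hQ, hℓ]
      ring
    rw [e3', ← e2', hψ0, map_zero]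
  -- point e1 + e2 + e3
  have hxe : d3 (e1 + e2 + e3) e2 e3 = D := by simp [hDdef, d3]; ring
  have hye : d3 e1 (e1 + e2 + e3) e3 = D := by simp [hDdef, d3]; ring
  have hze : d3 e1 e2 (e1 + e2 + e3) = D := by simp [hDdef, d3]; ring
  have hQf : eval (e1 + e2 + e3) Q = 0 := by
    simp only [hQ, map_add, map_mul, eval_C, hx, hy, hz, hxe, hye, hze]
    linear_combination D * D * hc
  have hℓf : eval (e1 + e2 + e3) (ℓ * C D) ≠ 0 := by
    simp only [hℓ, map_add, map_mul, eval_C, hx, hy, hxe, hye]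
    have : (c1 * D + c2 * D) * D = - c3 * D * D := by linear_combination D * D * hc
    rw [this]
    simp [h3, hD]
  have hQ0 : Q ≠ 0 := by
    intro hQz
    have hxe : d3 (e1 + e2) e2 e3 = D := by simp [hDdef, d3]; ring
    have hye : d3 e1 (e1 + e2) e3 = D := by simp [hDdef, d3]; ring
    have hze : d3 e1 e2 (e1 + e2) = 0 := by simp [d3]; ring
    have := congrArg (eval (e1 + e2)) hQz
    simp only [hQ, map_add, map_mul, eval_C, hx, hy, hz, hxe, hye, hze, map_zero] at this
    simp [h3, hD] at this
  have hQhom : Q.IsHomogeneous 2 := by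
    have h := fun a b c => ((linF_hom a).mul (linF_hom b)).C_mul c
    exact ((h _ _ _).add (h _ _ _)).add (h _ _ _)
  obtain ⟨H, hH⟩ := hdvd
  have hGp : Prime G := hirr.prime
  have hdv : G ∣ Q * H := ⟨(ℓ * C D) ^ d, by rw [← hH]; ring⟩
  rcases hGp.dvd_or_dvd hdv with h | h
  · obtain ⟨K, hK⟩ := h
    have hK0 : K ≠ 0 := by rintro rfl; simp at hK; exact hQ0 hK
    have h5 := totalDegree_mul_of_isDomain hirr.ne_zero hK0
    rw [← hK, hQhom.totalDegree hQ0, hG.totalDegree hirr.ne_zero] at h5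
    omega
  · exfalso
    obtain ⟨K, hK⟩ := h
    have h6 : (ℓ * C D) ^ d = Q * K := by
      apply mul_right_cancel₀ hirr.ne_zero
      rw [hH, hK]; ring
    have := congrArg (eval (e1 + e2 + e3)) h6
    rw [map_pow, map_mul (eval _) Q K, hQf, zero_mul] at this
    exact hℓf (eq_zero_of_pow_eq_zero this)

theorem conic_norm {G : MvPolynomial (Fin 3) ℂ} {d : ℕ} (hG : G.IsHomogeneous d)
    (hirr : Irreducible G) (e1 e2 e3 : Fin 3 → ℂ) (hD : d3 e1 e2 e3 ≠ 0)
    (a b c : ℂ) (ha : a ≠ 0) (hb : b ≠ 0) (hc : c ≠ 0) (hab : a - b ≠ 0) (hbc : b - c ≠ 0)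
    (hca : c - a ≠ 0) (v : Fin 5 → Fin 3 → ℂ)
    (hv : v = ![e1, e2, e3, e1 + e2 + e3, a • e1 + b • e2 + c • e3])
    (m : Fin 5 → ℕ) (hm : ∀ i, HasMultGE G (v i) (m i)) :
    ∑ i, m i ≤ 2 * d ∨ (d ≤ 2 ∧ ∀ i, eval (v i) G = 0) := by
  set c1 := a * (b - c) with hc1
  set c2 := b * (c - a) with hc2
  set c3 := c * (a - b) with hc3
  have h1 : c1 ≠ 0 := mul_ne_zero ha hbc
  have h2 : c2 ≠ 0 := mul_ne_zero hb hca
  have h3 : c3 ≠ 0 := mul_ne_zero hc hab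
  have hsum : c1 + c2 + c3 = 0 := by rw [hc1, hc2, hc3]; ring
  obtain ⟨κ, hκ⟩ := Infinite.exists_notMem_finset ({0, 1, b / a, - c2 / c1} : Finset ℂ)
  simp only [Finset.mem_insert, Finset.mem_singleton, not_or] at hκ
  obtain ⟨k0, k1, k2, k3⟩ := hκ
  have k1' : 1 - κ ≠ 0 := sub_ne_zero.2 (Ne.symm k1)
  have k2' : b - a * κ ≠ 0 := by
    intro h; apply k2; field_simp; linear_combination -h
  have k3' : c1 * κ + c2 ≠ 0 := by
    intro h; apply k3; field_simp; linear_combination h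
  set φ := cpar e1 e2 e3 c1 c2 c3 κ with hφ
  set r : Fin 5 → ℂ := ![0, 1, c2 / (c1 * κ + c2), 1 / (1 - κ), b / (b - a * κ)] with hr
  have hrinj : Function.Injective r := by
    have n02 : c2 / (c1 * κ + c2) ≠ 0 := div_ne_zero h2 k3'
    have n03 : 1 / (1 - κ) ≠ 0 := div_ne_zero one_ne_zero k1'
    have n04 : b / (b - a * κ) ≠ 0 := div_ne_zero hb k2'
    have n12 : c2 / (c1 * κ + c2) ≠ 1 := by
      intro h; rw [div_eq_one_iff_eq k3'] at h
      exact mul_ne_zero h1 k0 (by linear_combination -h)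
    have n13 : 1 / (1 - κ) ≠ 1 := by
      intro h; rw [div_eq_one_iff_eq k1'] at h
      exact k0 (by linear_combination h)
    have n14 : b / (b - a * κ) ≠ 1 := by
      intro h; rw [div_eq_one_iff_eq k2'] at h
      exact mul_ne_zero ha k0 (by linear_combination h)
    have n23 : c2 / (c1 * κ + c2) ≠ 1 / (1 - κ) := by
      intro h; rw [div_eq_div_iff k3' k1'] at h
      exact mul_ne_zero h3 k0 (by linear_combination h + κ * hsum)
    have n24 : c2 / (c1 * κ + c2) ≠ b / (b - a * κ) := by
      intro h; rw [div_eq_div_iff k3' k2'] at h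
      exact mul_ne_zero (mul_ne_zero (mul_ne_zero ha hb) hab) k0
        (by rw [hc1, hc2] at h; linear_combination h)
    have n34 : 1 / (1 - κ) ≠ b / (b - a * κ) := by
      intro h; rw [div_eq_div_iff k1' k2'] at h
      exact mul_ne_zero hab k0 (by linear_combination -h)
    intro i j hij
    fin_cases i <;> fin_cases j <;> simp [hr] at hij ⊢ <;> simp_all
  have hs : ∀ i, ∃ s : ℂ, s ≠ 0 ∧ ∀ j, Polynomial.eval (r i) (φ j) = s * v i j := by
    intro i
    simp only [hφ, cpar_eval, hv]
    fin_cases i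
    · refine ⟨c2, h2, fun j => ?_⟩
      simp [hr]; ring
    · refine ⟨c1 * κ ^ 2, mul_ne_zero h1 (pow_ne_zero _ k0), fun j => ?_⟩
      simp [hr]; ring
    · obtain ⟨q, hq⟩ : ∃ q, q = c2 / (c1 * κ + c2) := ⟨_, rfl⟩
      have hq' : q * (c1 * κ + c2) = c2 := by rw [hq]; field_simp
      refine ⟨-c3 * (q - 1) * (κ * q), ?_, fun j => ?_⟩
      · have q0 : q ≠ 0 := by rw [hq]; exact div_ne_zero h2 k3'
        have q1 : q - 1 ≠ 0 := by
          intro h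
          exact mul_ne_zero h1 k0 (by linear_combination hq' - (c1 * κ + c2) * h)
        simp [h3, q0, q1, k0]
      · simp [hr]
        rw [← hq]
        linear_combination (e1 j * (q - 1) + e2 j * κ * q) * hq'
    · obtain ⟨q, hq⟩ : ∃ q, q = (1 - κ)⁻¹ := ⟨_, rfl⟩
      have hq' : q * (1 - κ) = 1 := by rw [hq]; field_simp
      have q0 : q ≠ 0 := by rw [hq]; exact inv_ne_zero k1'
      refine ⟨-c3 * (κ * q) ^ 2, by simp [h3, q0, k0], fun j => ?_⟩
      simp [hr]
      rw [← hq]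
      have e : q - 1 = κ * q := by linear_combination hq'
      rw [e]
      linear_combination (e1 j + e2 j) * (κ * q) ^ 2 * hsum
    · obtain ⟨q, hq⟩ : ∃ q, q = κ / (b - a * κ) := ⟨_, rfl⟩
      have q0 : q ≠ 0 := by rw [hq]; exact div_ne_zero k0 k2'
      have ex : b / (b - a * κ) - 1 = a * q := by rw [hq]; field_simp; ring
      have ey : κ * (b / (b - a * κ)) = b * q := by rw [hq]; field_simp
      refine ⟨-(a * b * (a - b)) * q ^ 2, by simp [ha, hb, hab, q0], fun j => ?_⟩
      simp [hr]
      rw [ex, ey, hc1, hc2, hc3]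
      ring
  by_cases h0 : aeval φ G = 0
  · right
    refine ⟨dvd_conic hG hirr e1 e2 e3 hD c1 c2 c3 κ hsum h3 k0 h0, fun i => ?_⟩
    obtain ⟨s, hs0, hs⟩ := hs i
    have := eval_aeval_poly G φ (r i)
    rw [h0] at this
    have e : (fun j => Polynomial.eval (r i) (φ j)) = s • v i := by ext j; rw [hs]; rfl
    rw [e, eval_smul_hom hG] at this
    simpa [hs0] using this.symm
  · left
    choose s hs0 hs using hs
    exact sum_mult_le hG φ (cpar_deg _ _ _ _ _ _ _) h0 v m hm r hrinj s hs

theorem five_pts {G : MvPolynomial (Fin 3) ℂ} {d : ℕ} (hG : G.IsHomogeneous d)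
    (hirr : Irreducible G) (v : Fin 5 → Fin 3 → ℂ)
    (hv : ∀ i j k, i ≠ j → i ≠ k → j ≠ k → d3 (v i) (v j) (v k) ≠ 0)
    (m : Fin 5 → ℕ) (hm : ∀ i, HasMultGE G (v i) (m i)) :
    ∑ i, m i ≤ 2 * d ∨ (d ≤ 2 ∧ ∀ i, eval (v i) G = 0) := by
  have D := hv 0 1 2 (by decide) (by decide) (by decide)
  have A1 := hv 3 1 2 (by decide) (by decide) (by decide)
  have A2 := hv 0 3 2 (by decide) (by decide) (by decide)
  have A3 := hv 0 1 3 (by decide) (by decide) (by decide)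
  have B1 := hv 4 1 2 (by decide) (by decide) (by decide)
  have B2 := hv 0 4 2 (by decide) (by decide) (by decide)
  have B3 := hv 0 1 4 (by decide) (by decide) (by decide)
  have E0 := hv 3 4 0 (by decide) (by decide) (by decide)
  have E1 := hv 3 4 1 (by decide) (by decide) (by decide)
  have E2 := hv 3 4 2 (by decide) (by decide) (by decide)
  set α : Fin 5 → ℂ := ![d3 (v 3) (v 1) (v 2), d3 (v 0) (v 3) (v 2), d3 (v 0) (v 1) (v 3),
    d3 (v 0) (v 1) (v 2), d3 (v 0) (v 1) (v 2)] with hα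
  have hα0 : ∀ i, α i ≠ 0 := by
    intro i; fin_cases i <;> simp [hα] <;> assumption
  have key := conic_norm hG hirr (α 0 • v 0) (α 1 • v 1) (α 2 • v 2)
    (by
      have : d3 (α 0 • v 0) (α 1 • v 1) (α 2 • v 2) = α 0 * α 1 * α 2 * d3 (v 0) (v 1) (v 2) := by
        simp only [d3, Pi.smul_apply, smul_eq_mul]; ring
      rw [this]
      simp [hα0, D])
    (d3 (v 4) (v 1) (v 2) / α 0) (d3 (v 0) (v 4) (v 2) / α 1) (d3 (v 0) (v 1) (v 4) / α 2)
    (div_ne_zero B1 (hα0 _)) (div_ne_zero B2 (hα0 _)) (div_ne_zero B3 (hα0 _))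
    (by
      rw [div_sub_div _ _ (hα0 _) (hα0 _)]
      refine div_ne_zero ?_ (mul_ne_zero (hα0 _) (hα0 _))
      convert mul_ne_zero (neg_ne_zero.2 D) E2 using 1
      simp only [hα, d3]; simp; ring)
    (by
      rw [div_sub_div _ _ (hα0 _) (hα0 _)]
      refine div_ne_zero ?_ (mul_ne_zero (hα0 _) (hα0 _))
      convert mul_ne_zero (neg_ne_zero.2 D) E0 using 1
      simp only [hα, d3]; simp; ring)
    (by
      rw [div_sub_div _ _ (hα0 _) (hα0 _)]
      refine div_ne_zero ?_ (mul_ne_zero (hα0 _) (hα0 _))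
      convert mul_ne_zero (neg_ne_zero.2 D) E1 using 1
      simp only [hα, d3]; simp; ring)
    (fun i => α i • v i)
    (by
      ext i j
      fin_cases i
      · rfl
      · rfl
      · rfl
      · have := cramer (v 0) (v 1) (v 2) (v 3) j
        simpa [hα] using this
      · have := cramer (v 0) (v 1) (v 2) (v 4) j
        have h0 := hα0 0
        have h1 := hα0 1
        have h2 := hα0 2
        simp only [Fin.reduceFinMk, Matrix.cons_val, Pi.add_apply, Pi.smul_apply, smul_eq_mul]
        have h4 : α 4 = d3 (v 0) (v 1) (v 2) := rfl
        rw [h4, this]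
        field_simp)
    m (fun i => (hm i).smul hG _)
  refine key.imp id fun ⟨h, h'⟩ => ⟨h, fun i => ?_⟩
  have := h' i
  rw [eval_smul_hom hG] at this
  simpa [hα0 i] using this

open Classical in
/-- The indices of the points on which `G` vanishes. -/
def vset (q : Fin 7 → P2) (G : MvPolynomial (Fin 3) ℂ) : Finset (Fin 7) :=
  Finset.univ.filter fun i => eval (q i).rep G = 0

theorem mem_vset {q : Fin 7 → P2} {G : MvPolynomial (Fin 3) ℂ} {i : Fin 7} :
    i ∈ vset q G ↔ eval (q i).rep G = 0 := by
  simp [vset]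

theorem card_line {q : Fin 7 → P2} (hq : GenPos q) {L : MvPolynomial (Fin 3) ℂ}
    (hL : L.IsHomogeneous 1) (h0 : L ≠ 0) : (vset q L).card ≤ 2 := by
  by_contra h
  have h3 : 3 ≤ (vset q L).card := by omega
  exact hq.2.1 ((vset q L).orderEmbOfCardLe h3).toEmbedding ⟨L, h0, hL, fun k =>
    mem_vset.1 ((vset q L).orderEmbOfCardLe_mem h3 k)⟩

theorem card_conic {q : Fin 7 → P2} (hq : GenPos q) {L : MvPolynomial (Fin 3) ℂ}
    (hL : L.IsHomogeneous 2) (h0 : L ≠ 0) : (vset q L).card ≤ 5 := by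
  by_contra h
  have h3 : 6 ≤ (vset q L).card := by omega
  exact hq.2.2.1 ((vset q L).orderEmbOfCardLe h3).toEmbedding ⟨L, h0, hL, fun k =>
    mem_vset.1 ((vset q L).orderEmbOfCardLe_mem h3 k)⟩

theorem d3_genPos {q : Fin 7 → P2} (hq : GenPos q) (i j k : Fin 7) (hij : i ≠ j) (hik : i ≠ k)
    (hjk : j ≠ k) : d3 (q i).rep (q j).rep (q k).rep ≠ 0 := by
  apply d3_ne_zero
  rintro ⟨L, h0, hL, h1, h2, h3⟩
  have := card_line hq hL h0
  have hs : ({i, j, k} : Finset (Fin 7)) ⊆ vset q L := by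
    intro a ha
    simp only [Finset.mem_insert, Finset.mem_singleton] at ha
    rcases ha with rfl | rfl | rfl <;> exact mem_vset.2 (by assumption)
  have h4 := Finset.card_le_card hs
  rw [Finset.card_eq_three.2 ⟨i, j, k, hij, hik, hjk, rfl⟩] at h4
  omega

theorem conic_sing {q : Fin 7 → P2} (hq : GenPos q) {G : MvPolynomial (Fin 3) ℂ}
    (hG : G.IsHomogeneous 2) (hcard : 4 ≤ (vset q G).card) (i : Fin 7)
    (hi : ∀ j, eval (q i).rep (pderiv j G) = 0) : G = 0 := by
  have h3 : 3 ≤ ((vset q G).erase i).card := by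
    have := Finset.pred_card_le_card_erase (s := vset q G) (a := i)
    omega
  set f := ((vset q G).erase i).orderEmbOfCardLe h3 with hf
  have hm : ∀ k, f k ∈ (vset q G).erase i := fun k => Finset.orderEmbOfCardLe_mem _ h3 k
  have hne : ∀ k, i ≠ f k := fun k => (Finset.ne_of_mem_erase (hm k)).symm
  have hv : ∀ k, eval (q (f k)).rep G = 0 := fun k => mem_vset.1 (Finset.mem_of_mem_erase (hm k))
  have hinj : ∀ a b, a ≠ b → f a ≠ f b := fun a b h h' => h (f.injective h')
  exact conic_lemma hG _ _ _ _ hi (hv 0) (hv 1) (hv 2)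
    (d3_genPos hq _ _ _ (hne _) (hne _) (hinj _ _ (by decide)))
    (d3_genPos hq _ _ _ (hne _) (hne _) (hinj _ _ (by decide)))
    (d3_genPos hq _ _ _ (hne _) (hne _) (hinj _ _ (by decide)))

theorem five_gen {q : Fin 7 → P2} (hq : GenPos q) {G : MvPolynomial (Fin 3) ℂ} {d : ℕ}
    (hG : G.IsHomogeneous d) (hirr : Irreducible G) (g : Fin 5 → Fin 7)
    (hg : Function.Injective g) :
    ∑ i, pMult G (q (g i)) ≤ 2 * d ∨
      (d = 2 ∧ ∑ i, pMult G (q i) ≤ 5 ∧ pMult G (q 6) ≤ 1) := by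
  have h0 := hirr.ne_zero
  rcases five_pts hG hirr (fun i => (q (g i)).rep)
    (fun i j k h1 h2 h3 => d3_genPos hq _ _ _ (hg.ne h1) (hg.ne h2) (hg.ne h3))
    (fun i => pMult G (q (g i))) (fun i => pMult_spec hG h0 _) with h | ⟨hd, hv⟩
  · exact Or.inl h
  right
  have hcard : 5 ≤ (vset q G).card := by
    have hs : Finset.univ.map ⟨g, hg⟩ ⊆ vset q G := by
      intro a ha
      simp only [Finset.mem_map, Finset.mem_univ, true_and, Function.Embedding.coeFn_mk] at ha
      obtain ⟨i, rfl⟩ := ha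
      exact mem_vset.2 (hv i)
    have := Finset.card_le_card hs
    simpa using this
  have hd2 : d = 2 := by
    interval_cases d
    · exfalso
      rw [← totalDegree_zero_iff_isHomogeneous, totalDegree_eq_zero_iff_eq_C] at hG
      have h1 : coeff 0 G = 0 := by
        have := hv 0
        rw [hG, eval_C] at this
        exact this
      rw [h1, map_zero] at hG
      exact h0 hG
    · exfalso
      have := card_line hq hG h0
      omega
    · rfl
  subst hd2
  have hle : ∀ i, pMult G (q i) ≤ if i ∈ vset q G then 1 else 0 := by
    intro i
    have hs := pMult_spec hG h0 (q i)
    split_ifs with hi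
    · by_contra hlt
      exact h0 (conic_sing hq hG (by omega) i fun j => hs.eval_pderiv (by omega) j)
    · by_contra hlt
      exact hi (mem_vset.2 (hs.eval_zero (by omega)))
  refine ⟨rfl, ?_, ?_⟩
  · calc ∑ i, pMult G (q i) ≤ ∑ i, (if i ∈ vset q G then 1 else 0) :=
          Finset.sum_le_sum fun i _ => hle i
      _ = (vset q G).card := by simp
      _ ≤ 5 := card_conic hq hG h0
  · refine (hle 6).trans ?_
    split_ifs <;> simp

theorem lower_bound {q : Fin 7 → P2} (hq : GenPos q) {G : MvPolynomial (Fin 3) ℂ} {d : ℕ}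
    (hG : G.IsHomogeneous d) (hirr : Irreducible G) :
    2 * ∑ i : Fin 6, pMult G (q i.castSucc) + 3 * pMult G (q (Fin.last 6)) ≤ 6 * d := by
  have h1 := five_gen hq hG hirr ![6, 0, 1, 2, 3] (by decide)
  have h2 := five_gen hq hG hirr ![6, 0, 1, 4, 5] (by decide)
  have h3 := five_gen hq hG hirr ![6, 2, 3, 4, 5] (by decide)
  simp only [Fin.sum_univ_succ, Finset.univ_eq_empty, Finset.sum_empty, Fin.sum_univ_zero] at h1 h2 h3 ⊢
  simp at h1 h2 h3 ⊢
  have e : Fin.last 6 = 6 := rfl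
  simp only [e] at *
  omega

theorem no_factor {q : Fin 7 → P2} (hq : GenPos q) {L Q : MvPolynomial (Fin 3) ℂ}
    (hL : L.IsHomogeneous 1) (hQ : Q.IsHomogeneous 2) (hL0 : L ≠ 0) (hQ0 : Q ≠ 0)
    (hv : ∀ i, eval (q i).rep (L * Q) = 0)
    (hs : ∀ j, eval (q 6).rep (pderiv j (L * Q)) = 0) : False := by
  have c1 := card_line hq hL hL0
  have c2 := card_conic hq hQ hQ0
  have hun : vset q L ∪ vset q Q = Finset.univ := by
    ext i
    have := hv i
    rw [map_mul, mul_eq_zero] at this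
    simpa [mem_vset] using this
  have hc := Finset.card_union_add_card_inter (vset q L) (vset q Q)
  rw [hun] at hc
  simp only [Finset.card_univ, Fintype.card_fin] at hc
  simp only [pderiv_mul, map_add, map_mul] at hs
  by_cases h6 : eval (q 6).rep L = 0
  · have hQ6 : eval (q 6).rep Q ≠ 0 := by
      intro h
      have : 6 ∈ vset q L ∩ vset q Q := Finset.mem_inter.2 ⟨mem_vset.2 h6, mem_vset.2 h⟩
      have := Finset.card_pos.2 ⟨_, this⟩
      omega
    have hp : ∀ j, pderiv j L = 0 := by
      intro j
      have h : (pderiv j L).IsHomogeneous 0 := hL.pderiv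
      rw [← totalDegree_zero_iff_isHomogeneous, totalDegree_eq_zero_iff_eq_C] at h
      have h2 := hs j
      rw [h6, zero_mul, add_zero, mul_eq_zero] at h2
      have h3 := h2.resolve_right hQ6
      rw [h, eval_C] at h3
      rw [h, h3, map_zero]
    apply hL0
    have := hL.sum_X_mul_pderiv
    simpa [hp] using this.symm
  · have hQ6 : eval (q 6).rep Q = 0 := by
      have := hv 6
      rw [map_mul, mul_eq_zero] at this
      exact this.resolve_left h6
    refine hQ0 (conic_sing hq hQ (by omega) 6 fun j => ?_)
    have := hs j
    rw [hQ6, mul_zero, zero_add, mul_eq_zero] at this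
    exact this.resolve_left h6

theorem exists_cubic_lin (v : Fin 6 → Fin 3 → ℂ) (y : Fin 3 → ℂ) :
    ∃ F : MvPolynomial (Fin 3) ℂ, F ≠ 0 ∧ F.IsHomogeneous 3 ∧ (∀ i, eval (v i) F = 0) ∧
      ∀ j, eval y (pderiv j F) = 0 := by
  let E : Fin 10 → (Fin 3 → ℕ) := ![![3,0,0], ![0,3,0], ![0,0,3], ![2,1,0], ![2,0,1], ![1,2,0],
    ![0,2,1], ![1,0,2], ![0,1,2], ![1,1,1]]
  have hE : Function.Injective E := by decide
  have hE3 : ∀ i, E i 0 + E i 1 + E i 2 = 3 := by decide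
  let e : Fin 10 → (Fin 3 →₀ ℕ) := fun i => Finsupp.equivFunOnFinite.symm (E i)
  have he : Function.Injective e := Finsupp.equivFunOnFinite.symm.injective.comp hE
  let Φ : (Fin 10 → ℂ) →ₗ[ℂ] MvPolynomial (Fin 3) ℂ :=
    Fintype.linearCombination ℂ (fun i => monomial (e i) (1 : ℂ))
  have hΦ : Function.Injective Φ := by
    have hli : LinearIndependent ℂ (fun i => monomial (e i) (1 : ℂ)) := by
      have := (basisMonomials (Fin 3) ℂ).linearIndependent.comp e he
      simpa [Function.comp_def] using this
    exact linearIndependent_iff_injective_fintypeLinearCombination.1 hli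
  let T : MvPolynomial (Fin 3) ℂ →ₗ[ℂ] (Fin 6 ⊕ Fin 3 → ℂ) :=
    LinearMap.pi (Sum.elim (fun i => (aeval (v i) : MvPolynomial (Fin 3) ℂ →ₐ[ℂ] ℂ).toLinearMap)
      (fun j => (aeval y : MvPolynomial (Fin 3) ℂ →ₐ[ℂ] ℂ).toLinearMap ∘ₗ
        (pderiv j : Derivation ℂ (MvPolynomial (Fin 3) ℂ) (MvPolynomial (Fin 3) ℂ)).toLinearMap))
  have hk : LinearMap.ker (T ∘ₗ Φ) ≠ ⊥ := by
    apply LinearMap.ker_ne_bot_of_finrank_lt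
    simp
  obtain ⟨c, hc, hc0⟩ := (Submodule.ne_bot_iff _).1 hk
  rw [LinearMap.mem_ker] at hc
  refine ⟨Φ c, ?_, ?_, ?_, ?_⟩
  · intro h; exact hc0 (hΦ (by rw [h, map_zero]))
  · rw [Fintype.linearCombination_apply]
    apply IsHomogeneous.sum
    intro i _
    rw [smul_monomial]
    apply isHomogeneous_monomial
    rw [Finsupp.degree_eq_sum, Fin.sum_univ_three]
    exact hE3 i
  · intro i
    have := congrFun hc (Sum.inl i)
    simpa [T, coe_aeval_eq_eval] using this
  · intro j
    have := congrFun hc (Sum.inr j)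
    simpa [T, coe_aeval_eq_eval] using this

theorem exists_cubic {q : Fin 7 → P2} (hq : GenPos q) :
    ∃ F : MvPolynomial (Fin 3) ℂ, F.IsHomogeneous 3 ∧ Irreducible F ∧
      (∀ i, 1 ≤ pMult F (q i)) ∧ 2 ≤ pMult F (q 6) := by
  obtain ⟨F, h0, hF, hv, hs⟩ := exists_cubic_lin (fun i : Fin 6 => (q i.castSucc).rep) (q 6).rep
  have h6 : eval (q 6).rep F = 0 := by
    have := euler_eval hF (q 6).rep
    simpa [hs] using this
  have hv' : ∀ i, eval (q i).rep F = 0 := by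
    intro i
    refine Fin.lastCases ?_ (fun j => hv j) i
    exact h6
  have hm : ∀ (v : Fin 3 → ℂ), eval v F = 0 → HasMultGE F v 1 := by
    intro v h k hk
    have k0 : k 0 = 0 := by omega
    have k1 : k 1 = 0 := by omega
    have k2 : k 2 = 0 := by omega
    simpa [iterDeriv, k0, k1, k2] using h
  refine ⟨F, hF, ⟨?_, ?_⟩, fun i => le_pMult hF h0 _ (hm _ (hv' i)), le_pMult hF h0 _ ?_⟩
  · intro hu
    rw [MvPolynomial.isUnit_iff_totalDegree_of_isReduced, hF.totalDegree h0] at hu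
    omega
  · intro A B hAB
    have hA : A ≠ 0 := by rintro rfl; simp at hAB; exact h0 hAB
    have hB : B ≠ 0 := by rintro rfl; simp at hAB; exact h0 hAB
    have hun : ∀ P : MvPolynomial (Fin 3) ℂ, P ≠ 0 → P.totalDegree = 0 → IsUnit P := by
      intro P hP hd
      rw [MvPolynomial.isUnit_iff_totalDegree_of_isReduced]
      refine ⟨?_, hd⟩
      rw [totalDegree_eq_zero_iff_eq_C] at hd
      rw [isUnit_iff_ne_zero]
      intro hz
      rw [hz, map_zero] at hd
      exact hP hd
    obtain ⟨hdeg, hfac⟩ := top_factor hF h0 hAB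
    have hA' := homogeneousComponent_isHomogeneous A.totalDegree A
    have hB' := homogeneousComponent_isHomogeneous B.totalDegree B
    set A' := homogeneousComponent A.totalDegree A
    set B' := homogeneousComponent B.totalDegree B
    have hA0 : A' ≠ 0 := by intro h; rw [h, zero_mul] at hfac; exact h0 hfac
    have hB0 : B' ≠ 0 := by intro h; rw [h, mul_zero] at hfac; exact h0 hfac
    by_cases a0 : A.totalDegree = 0
    · exact Or.inl (hun A hA a0)
    by_cases b0 : B.totalDegree = 0
    · exact Or.inr (hun B hB b0)
    exfalso
    by_cases a1 : A.totalDegree = 1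
    · have b2 : B.totalDegree = 2 := by omega
      rw [a1] at hA'
      rw [b2] at hB'
      exact no_factor hq hA' hB' hA0 hB0 (by rw [← hfac]; exact hv') (by rw [← hfac]; exact hs)
    · have a2 : A.totalDegree = 2 := by omega
      have b1 : B.totalDegree = 1 := by omega
      rw [a2] at hA'
      rw [b1] at hB'
      rw [mul_comm] at hfac
      exact no_factor hq hB' hA' hB0 hA0 (by rw [← hfac]; exact hv') (by rw [← hfac]; exact hs)
  · intro k hk
    by_cases hk0 : k 0 + k 1 + k 2 = 0
    · exact hm _ h6 k (by omega)
    have : ∃ j : Fin 3, k = Pi.single j 1 := by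
      by_cases a : k 0 = 1
      · refine ⟨0, ?_⟩; ext i; fin_cases i <;> simp <;> omega
      by_cases b : k 1 = 1
      · refine ⟨1, ?_⟩; ext i; fin_cases i <;> simp <;> omega
      · refine ⟨2, ?_⟩; ext i; fin_cases i <;> simp <;> omega
    obtain ⟨j, rfl⟩ := this
    rw [← hs j]
    have := iterDeriv_pderiv 0 j F
    rw [zero_add] at this
    rw [← this]
    simp [iterDeriv]

/-- Let `X₆` be the blow-up of `ℙ²` at `6` distinct points in general position and let `x`
be a point of `X₆` in general position.  Then the Seshadri constant of the anticanonical
divisor `-K_{X₆}` at `x` equals `3/2`. -/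
theorem seshadri_antiK_blowup_six_genPos
    (pts : Fin 6 → P2) (hpts : GenPos pts)
    (B : BlowupP2 6 pts) (x : B.X) (hx : B.genPosPt x) :
    B.seshadri x = 3 / 2 := by
  obtain ⟨hxr, hq⟩ := hx
  have hq6 : (Fin.snoc pts (B.μ x) : Fin 7 → P2) 6 = B.μ x :=
    Fin.snoc_last (α := fun _ => P2) (B.μ x) pts
  have hqi : ∀ i : Fin 6, (Fin.snoc pts (B.μ x) : Fin 7 → P2) i.castSucc = pts i := fun i =>
    Fin.snoc_castSucc (α := fun _ => P2) (B.μ x) pts i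
  have hlow : ∀ t ∈ {t : ℝ | ∃ C : B.Curve, B.mem x C ∧
      t = (B.interK C : ℝ) / (B.mult x C : ℝ)}, 3 / 2 ≤ t := by
    rintro t ⟨C, hC, rfl⟩
    have hpos : 0 < B.mult x C := (B.mult_pos_iff x C).2 hC
    rcases B.curve_cases C with ⟨i, rfl⟩ | ⟨d, G, hG, hirr, hd, hE, hmem, -⟩
    · exact absurd ⟨i, ((B.mem_exc i x).1 hC).symm⟩ hxr
    have hb := lower_bound hq hG hirr
    have e6 : Fin.last 6 = 6 := rfl
    rw [e6, hq6, ← (hmem x hxr).2] at hb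
    simp only [hqi] at hb
    have hK := B.interK_eq C
    simp only [hE, hd] at hK
    have hb' : 2 * ∑ i : Fin 6, (pMult G (pts i) : ℤ) + 3 * (B.mult x C : ℤ) ≤ 6 * (d : ℤ) := by
      exact_mod_cast hb
    have h1 : 3 * (B.mult x C : ℤ) ≤ 2 * B.interK C := by rw [hK]; linarith
    have h2 : 3 * (B.mult x C : ℝ) ≤ 2 * (B.interK C : ℝ) := by exact_mod_cast h1
    rw [le_div_iff₀ (by exact_mod_cast hpos)]
    linarith
  obtain ⟨F, hF, hirr, hv, h2⟩ := exists_cubic hq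
  obtain ⟨C, hd, hE, hmem, -⟩ := B.strict_exists 3 F hF hirr
  rw [hq6, ← (hmem x hxr).2] at h2
  have hC : B.mem x C := (B.mult_pos_iff x C).1 (by omega)
  have hin : (B.interK C : ℝ) / (B.mult x C : ℝ) ∈ {t : ℝ | ∃ C : B.Curve, B.mem x C ∧
      t = (B.interK C : ℝ) / (B.mult x C : ℝ)} := ⟨C, hC, rfl⟩
  have hup : (B.interK C : ℝ) / (B.mult x C : ℝ) ≤ 3 / 2 := by
    have hK := B.interK_eq C
    simp only [hE, hd] at hK
    have hs : (6 : ℤ) ≤ ∑ i : Fin 6, (pMult F (pts i) : ℤ) := by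
      have : ∑ i : Fin 6, (1 : ℤ) ≤ ∑ i : Fin 6, (pMult F (pts i) : ℤ) := by
        refine Finset.sum_le_sum fun i _ => ?_
        have := hv i.castSucc
        rw [hqi] at this
        exact_mod_cast this
      simpa using this
    have h3 : B.interK C ≤ 3 := by
      rw [hK]; push_cast; linarith
    have h3' : (B.interK C : ℝ) ≤ 3 := by exact_mod_cast h3
    have h2' : (2 : ℝ) ≤ (B.mult x C : ℝ) := by exact_mod_cast h2
    rw [div_le_iff₀ (by linarith)]
    linarith
  exact le_antisymm ((csInf_le ⟨3 / 2, hlow⟩ hin).trans hup) (le_csInf ⟨_, hin⟩ hlow)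
end
end

section
/- Let X_7 be the blow-up of the complex projective plane at 7 distinct points x_1, …, x_7 in general position, and let x be a point of X_7 in general position. Then the Seshadri constant of the anticanonical divisor −K_{X_7} at x equals 4/3. -/
open MvPolynomial

noncomputable section

def tr (v : Fin 3 → ℂ) : MvPolynomial (Fin 3) ℂ →ₐ[ℂ] MvPolynomial (Fin 3) ℂ :=
  aeval (fun i => X i + C (v i))

def od (v : Fin 3 → ℂ) (F : MvPolynomial (Fin 3) ℂ) : ℕ∞ :=
  ((tr v F : MvPolynomial (Fin 3) ℂ) : MvPowerSeries (Fin 3) ℂ).order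

lemma tr_pderiv (v : Fin 3 → ℂ) (i : Fin 3) (F : MvPolynomial (Fin 3) ℂ) :
    tr v (pderiv i F) = pderiv i (tr v F) := by
  induction F using MvPolynomial.induction_on with
  | C a => simp [tr]
  | add p q hp hq => simp [hp, hq]
  | mul_X p j hp =>
    simp only [pderiv_mul, map_add, map_mul, hp]
    congr 1
    by_cases h : j = i
    · subst h; simp [tr]
    · simp [tr, pderiv_X_of_ne h]

lemma coeff_zero_tr (v : Fin 3 → ℂ) (F : MvPolynomial (Fin 3) ℂ) :
    coeff 0 (tr v F) = eval v F := by
  change constantCoeff (tr v F) = _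
  induction F using MvPolynomial.induction_on with
  | C a => simp [tr]
  | add p q hp hq => simp [hp, hq]
  | mul_X p j hp => simp [hp]; left; simp [tr]

lemma coeff_iter_pderiv (i : Fin 3) (n : ℕ) : ∀ m : Fin 3 →₀ ℕ, ∃ c : ℂ, c ≠ 0 ∧
    ∀ P : MvPolynomial (Fin 3) ℂ, coeff m ((fun G => pderiv i G)^[n] P) =
      c * coeff (m + Finsupp.single i n) P := by
  induction n with
  | zero => intro m; exact ⟨1, one_ne_zero, by simp⟩
  | succ n ih =>
    intro m
    obtain ⟨c, hc, h⟩ := ih (m + Finsupp.single i 1)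
    refine ⟨c * (m i + 1), mul_ne_zero hc (Nat.cast_add_one_ne_zero _), fun P => ?_⟩
    rw [Function.iterate_succ_apply', coeff_pderiv, h, add_assoc, ← Finsupp.single_add, add_comm 1 n]
    ring

lemma tr_iter (v : Fin 3 → ℂ) (i : Fin 3) (n : ℕ) (F : MvPolynomial (Fin 3) ℂ) :
    tr v ((fun G => pderiv i G)^[n] F) = (fun G => pderiv i G)^[n] (tr v F) := by
  induction n generalizing F with
  | zero => rfl
  | succ n ih => rw [Function.iterate_succ_apply, ih, tr_pderiv, Function.iterate_succ_apply]

lemma eval_iterDeriv (v : Fin 3 → ℂ) (k : Fin 3 → ℕ) : ∃ c : ℂ, c ≠ 0 ∧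
    ∀ F : MvPolynomial (Fin 3) ℂ, eval v (iterDeriv k F) =
      c * coeff (Finsupp.equivFunOnFinite.symm k) (tr v F) := by
  obtain ⟨c0, h0, H0⟩ := coeff_iter_pderiv 0 (k 0) 0
  obtain ⟨c1, h1, H1⟩ := coeff_iter_pderiv 1 (k 1) (0 + Finsupp.single 0 (k 0))
  obtain ⟨c2, h2, H2⟩ := coeff_iter_pderiv 2 (k 2) (0 + Finsupp.single 0 (k 0) + Finsupp.single 1 (k 1))
  refine ⟨c0 * c1 * c2, by simp [h0, h1, h2], fun F => ?_⟩
  rw [← coeff_zero_tr, iterDeriv, tr_iter, tr_iter, tr_iter, H0, H1, H2]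
  have : (0 + Finsupp.single 0 (k 0) + Finsupp.single 1 (k 1) + Finsupp.single 2 (k 2) : Fin 3 →₀ ℕ)
    = Finsupp.equivFunOnFinite.symm k := by
    ext j; fin_cases j <;> simp
  rw [this]; ring

lemma degree_fin3 (d : Fin 3 →₀ ℕ) : d.degree = d 0 + d 1 + d 2 := by
  rw [Finsupp.degree_eq_sum, Fin.sum_univ_three]

lemma hasMultGE_iff (F : MvPolynomial (Fin 3) ℂ) (v : Fin 3 → ℂ) (m : ℕ) :
    HasMultGE F v m ↔ (m : ℕ∞) ≤ od v F := by
  constructor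
  · intro h
    apply MvPowerSeries.nat_le_order
    intro d hd
    rw [degree_fin3] at hd
    obtain ⟨c, hc, H⟩ := eval_iterDeriv v d
    have := h d hd
    rw [H] at this
    rw [coeff_coe]
    simpa [hc] using this
  · intro h k hk
    obtain ⟨c, hc, H⟩ := eval_iterDeriv v k
    rw [H, ← coeff_coe, MvPowerSeries.coeff_of_lt_order, mul_zero]
    refine lt_of_lt_of_le ?_ h
    rw [degree_fin3]
    exact_mod_cast hk

lemma order_mul' (f g : MvPowerSeries (Fin 3) ℂ) : (f * g).order = f.order + g.order := by
  by_cases hf : f = 0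
  · simp [hf]
  by_cases hg : g = 0
  · simp [hg]
  apply le_antisymm _ MvPowerSeries.le_order_mul
  have hf' := MvPowerSeries.ne_zero_iff_order_finite.1 hf
  have hg' := MvPowerSeries.ne_zero_iff_order_finite.1 hg
  have h1 := MvPowerSeries.homogeneousComponent_of_order (f := f) hf'
  have h2 := MvPowerSeries.homogeneousComponent_of_order (f := g) hg'
  have h3 := MvPowerSeries.homogeneousComponent_mul_of_le_order (f := f) (g := g) hf'.le hg'.le
  by_contra hlt
  rw [not_le, ← hf', ← hg'] at hlt
  rw [MvPowerSeries.homogeneousComponent_of_lt_order_eq_zero (by exact_mod_cast hlt)] at h3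
  exact mul_ne_zero h1 h2 h3.symm

lemma od_mul (v : Fin 3 → ℂ) (F G : MvPolynomial (Fin 3) ℂ) :
    od v (F * G) = od v F + od v G := by
  simp [od, order_mul']

lemma tr_neg (v : Fin 3 → ℂ) (F : MvPolynomial (Fin 3) ℂ) : tr (-v) (tr v F) = F := by
  have : (tr (-v)).comp (tr v) = AlgHom.id ℂ _ := by
    apply MvPolynomial.algHom_ext
    intro i; simp [tr]
  exact DFunLike.congr_fun this F

lemma od_eq_top (v : Fin 3 → ℂ) (F : MvPolynomial (Fin 3) ℂ) : od v F = ⊤ ↔ F = 0 := by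
  rw [od, MvPowerSeries.order_eq_top_iff]
  constructor
  · intro h
    have : tr v F = 0 := by exact_mod_cast h
    rw [← tr_neg v F, this, map_zero]
  · rintro rfl; simp

lemma od_add (v : Fin 3 → ℂ) (F G : MvPolynomial (Fin 3) ℂ) :
    min (od v F) (od v G) ≤ od v (F + G) := by
  simp only [od, map_add, MvPolynomial.coe_add]
  exact MvPowerSeries.min_order_le_add

lemma od_smul (v : Fin 3 → ℂ) (c : ℂ) (F : MvPolynomial (Fin 3) ℂ) :
    od v F ≤ od v (c • F) := by
  rw [← C_mul', od_mul]; exact le_add_self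

lemma one_le_od (v : Fin 3 → ℂ) (F : MvPolynomial (Fin 3) ℂ) :
    1 ≤ od v F ↔ eval v F = 0 := by
  rw [od, MvPowerSeries.one_le_order_iff_constCoeff_eq_zero, ← coeff_zero_tr]
  simp [← MvPowerSeries.coeff_zero_eq_constantCoeff_apply]

lemma totalDegree_tr (v : Fin 3 → ℂ) (F : MvPolynomial (Fin 3) ℂ) :
    (tr v F).totalDegree ≤ F.totalDegree := by
  conv_lhs => rw [F.as_sum]
  rw [map_sum]
  refine (totalDegree_finsetSum _ _).trans (Finset.sup_le fun d hd => ?_)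
  refine le_trans ?_ (le_totalDegree hd)
  rw [tr, aeval_monomial]
  refine (totalDegree_mul _ _).trans ?_
  simp only [algebraMap_eq, totalDegree_C, zero_add]
  refine (totalDegree_finsetProd _ _).trans ?_
  apply Finset.sum_le_sum
  intro i _
  refine (totalDegree_pow _ _).trans ?_
  have : (X i + C (v i) : MvPolynomial (Fin 3) ℂ).totalDegree ≤ 1 := by
    refine (totalDegree_add _ _).trans ?_
    simp
  nlinarith

lemma od_le {v : Fin 3 → ℂ} {F : MvPolynomial (Fin 3) ℂ} {d : ℕ} (hF : F.IsHomogeneous d)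
    (h : F ≠ 0) : od v F ≤ d := by
  have h0 : tr v F ≠ 0 := fun h' => h (by rw [← tr_neg v F, h', map_zero])
  obtain ⟨k, hk⟩ := exists_coeff_ne_zero h0
  refine (MvPowerSeries.order_le (d := k) (by rwa [coeff_coe])).trans ?_
  have := le_totalDegree (mem_support_iff.2 hk)
  have h2 := (totalDegree_tr v F).trans hF.totalDegree_le
  rw [Nat.cast_le, degree_fin3]
  rw [Finsupp.sum_fintype _ _ (by simp), Fin.sum_univ_three] at this
  omega

lemma pMult_eq {F : MvPolynomial (Fin 3) ℂ} (hF : F ≠ 0) (p : P2) :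
    (pMult F p : ℕ∞) = od p.rep F := by
  have h : od p.rep F ≠ ⊤ := by simpa [od_eq_top] using hF
  obtain ⟨n, hn⟩ := ENat.ne_top_iff_exists.1 h
  rw [← hn]
  congr 1
  have : {m : ℕ | pHasMultGE F p m} = Set.Iic n := by
    ext m; simp [pHasMultGE, hasMultGE_iff, ← hn]
  rw [pMult, this, csSup_Iic]

lemma isHomogeneous_of_mul {F G : MvPolynomial (Fin 3) ℂ} {d : ℕ}
    (h : (F * G).IsHomogeneous d) (h0 : F * G ≠ 0) : F.IsHomogeneous F.totalDegree := by
  have hF := left_ne_zero_of_mul h0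
  have hG := right_ne_zero_of_mul h0
  have key : ∀ P : MvPolynomial (Fin 3) ℂ, P ≠ 0 →
      (P : MvPowerSeries (Fin 3) ℂ).order ≤ P.totalDegree := by
    intro P hP
    obtain ⟨k, hk⟩ := exists_coeff_ne_zero hP
    refine (MvPowerSeries.order_le (d := k) (by rwa [coeff_coe])).trans ?_
    have := le_totalDegree (mem_support_iff.2 hk)
    rw [Nat.cast_le, degree_fin3]
    rw [Finsupp.sum_fintype _ _ (by simp), Fin.sum_univ_three] at this
    omega
  have h1 := totalDegree_mul_of_isDomain hF hG
  rw [h.totalDegree h0] at h1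
  have h2 : (d : ℕ∞) ≤ ((F * G : MvPolynomial (Fin 3) ℂ) : MvPowerSeries (Fin 3) ℂ).order := by
    apply MvPowerSeries.nat_le_order
    intro k hk
    rw [coeff_coe]
    exact h.coeff_eq_zero hk.ne
  rw [coe_mul, order_mul'] at h2
  have h3 := key F hF
  have h4 := key G hG
  have h5 : (F.totalDegree : ℕ∞) ≤ (F : MvPowerSeries (Fin 3) ℂ).order := by
    have hf : (F : MvPowerSeries (Fin 3) ℂ).order ≠ ⊤ := ne_top_of_le_ne_top (by simp) h3
    have hg : (G : MvPowerSeries (Fin 3) ℂ).order ≠ ⊤ := ne_top_of_le_ne_top (by simp) h4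
    obtain ⟨a, ha⟩ := ENat.ne_top_iff_exists.1 hf
    obtain ⟨b, hb⟩ := ENat.ne_top_iff_exists.1 hg
    rw [← ha, ← hb] at h2
    rw [← ha] at h3 ⊢
    rw [← hb] at h4
    norm_cast at h2 h3 h4 ⊢
    omega
  intro k hk
  have h6 := MvPowerSeries.order_le (d := k) (f := (F : MvPowerSeries (Fin 3) ℂ)) (by rwa [coeff_coe])
  have h7 := le_totalDegree (mem_support_iff.2 hk)
  have h8 := h5.trans h6
  rw [Nat.cast_le, degree_fin3] at h8
  rw [Finsupp.sum_fintype _ _ (by simp), Fin.sum_univ_three] at h7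
  have h9 : Finsupp.weight 1 k = k.degree := by
    rw [Finsupp.degree_eq_weight_one]; rfl
  rw [h9, degree_fin3]
  omega

abbrev SS (t : ℕ) : Submodule ℂ (MvPolynomial (Fin 3) ℂ) := homogeneousSubmodule (Fin 3) ℂ t

lemma choose2 (n : ℕ) : (n + 1).choose 2 * 2 = (n + 1) * n := by
  induction n with
  | zero => rfl
  | succ n ih =>
    rw [Nat.choose_succ_succ' (n + 1) 1, Nat.choose_one_right]
    linarith

lemma card_anti (n : ℕ) : (Finset.finsuppAntidiag (Finset.univ : Finset (Fin 3)) n).card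
    = (n + 2).choose 2 := by
  rw [Finset.card_finsuppAntidiag_nat_eq_choose]
  simp only [Finset.card_univ, Fintype.card_fin]
  rw [show 3 + n - 1 = n + 2 by omega, ← Nat.choose_symm (by omega : 2 ≤ n + 2)]
  simp

lemma mem_anti (n : ℕ) (k : Fin 3 →₀ ℕ) :
    k ∈ Finset.finsuppAntidiag (Finset.univ : Finset (Fin 3)) n ↔ k.degree = n := by
  rw [Finset.mem_finsuppAntidiag, Finsupp.degree_eq_sum]
  simp

instance SS_fin (t : ℕ) : Module.Finite ℂ (SS t) :=
  Module.Finite.iff_fg.2 (homogeneousSubmodule_fg (σ := Fin 3) (R := ℂ) t)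

lemma finrank_SS (t : ℕ) : Module.finrank ℂ (SS t) = (t + 2).choose 2 := by
  have e : SS t ≃ₗ[ℂ] ((Finset.finsuppAntidiag (Finset.univ : Finset (Fin 3)) t) → ℂ) := 
    LinearEquiv.ofBijective
      (LinearMap.pi (fun k => (lcoeff ℂ k.1).comp (SS t).subtype)) (by
        constructor
        · rw [injective_iff_map_eq_zero]
          rintro ⟨A, hA⟩ h
          ext k
          by_cases hk : k.degree = t
          · have := congrFun h ⟨k, (mem_anti t k).2 hk⟩
            simpa using this
          · simpa using IsHomogeneous.coeff_eq_zero hA hk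
        · intro f
          refine ⟨⟨∑ k, monomial k.1 (f k), Submodule.sum_mem _ fun k _ => ?_⟩, ?_⟩
          · exact isHomogeneous_monomial _ ((mem_anti t k.1).1 k.2)
          · ext k
            simp [coeff_monomial])
  rw [e.finrank_eq, Module.finrank_fintype_fun_eq_card, Fintype.card_coe, card_anti]

def LS {ι : Type} (v : ι → Fin 3 → ℂ) (t : ℕ) (c : ι → ℕ) :
    Submodule ℂ (MvPolynomial (Fin 3) ℂ) where
  carrier := {A | A.IsHomogeneous t ∧ ∀ i, (c i : ℕ∞) ≤ od (v i) A}
  zero_mem' := ⟨isHomogeneous_zero _ _ _, fun i => by rw [(od_eq_top _ _).2 rfl]; exact le_top⟩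
  add_mem' := fun h1 h2 => ⟨h1.1.add h2.1, fun i =>
    (le_min (h1.2 i) (h2.2 i)).trans (od_add _ _ _)⟩
  smul_mem' := fun a A h => ⟨(SS t).smul_mem a h.1, fun i => (h.2 i).trans (od_smul _ _ _)⟩

lemma mem_LS {ι : Type} {v : ι → Fin 3 → ℂ} {t : ℕ} {c : ι → ℕ} {A : MvPolynomial (Fin 3) ℂ} :
    A ∈ LS v t c ↔ A.IsHomogeneous t ∧ ∀ i, (c i : ℕ∞) ≤ od (v i) A := Iff.rfl

lemma LS_le {ι : Type} (v : ι → Fin 3 → ℂ) (t : ℕ) (c : ι → ℕ) : LS v t c ≤ SS t :=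
  fun _ h => h.1

instance LS_fin {ι : Type} (v : ι → Fin 3 → ℂ) (t : ℕ) (c : ι → ℕ) :
    Module.Finite ℂ (LS v t c) := Submodule.finiteDimensional_of_le (LS_le v t c)

lemma coeff_X_mul_pderiv (i : Fin 3) (P : MvPolynomial (Fin 3) ℂ) (k : Fin 3 →₀ ℕ) :
    coeff k (X i * pderiv i P) = k i * coeff k P := by
  induction P using MvPolynomial.induction_on' with
  | add p q hp hq => simp [mul_add, hp, hq]
  | monomial n a =>
    rw [X_mul_pderiv_monomial, coeff_smul, coeff_monomial]
    by_cases h : n = k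
    · simp [h]
    · simp [h]

lemma euler_coeff (v : Fin 3 → ℂ) {A : MvPolynomial (Fin 3) ℂ} {t : ℕ} (hA : A.IsHomogeneous t)
    (k : Fin 3 →₀ ℕ) : ((t : ℂ) - k.degree) * coeff k (tr v A) =
      ∑ i, v i * ((k i + 1) * coeff (k + Finsupp.single i 1) (tr v A)) := by
  have h := congrArg (fun P => coeff k (tr v P)) hA.sum_X_mul_pderiv
  simp only [map_sum, map_mul, tr_pderiv, ← Nat.cast_smul_eq_nsmul ℂ, map_smul] at h
  have hX : ∀ i, tr v (X i) = X i + C (v i) := fun i => by simp [tr]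
  simp only [hX, add_mul, coeff_sum, coeff_add, coeff_X_mul_pderiv, coeff_C_mul, coeff_pderiv,
    coeff_smul, Finset.sum_add_distrib, smul_eq_mul, ← Finset.sum_mul] at h
  rw [sub_mul, ← h, Finsupp.degree_eq_sum]
  push_cast
  rw [add_sub_cancel_left]
  refine Finset.sum_congr rfl fun i _ => by ring

lemma od_ge_of_top {v : Fin 3 → ℂ} {A : MvPolynomial (Fin 3) ℂ} {t : ℕ} (hA : A.IsHomogeneous t)
    {m : ℕ} (hm : m ≤ t) (h : ∀ k : Fin 3 →₀ ℕ, k.degree = m → coeff k (tr v A) = 0) :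
    ((m + 1 : ℕ) : ℕ∞) ≤ od v A := by
  have key : ∀ j, j ≤ m → ∀ k : Fin 3 →₀ ℕ, k.degree = m - j → coeff k (tr v A) = 0 := by
    intro j
    induction j with
    | zero => intro _ k hk; exact h k hk
    | succ j ih =>
      intro hj k hk
      have := euler_coeff v hA k
      rw [Finset.sum_eq_zero] at this
      · rcases mul_eq_zero.1 this with h' | h'
        · exfalso
          rw [sub_eq_zero, Nat.cast_inj] at h'
          omega
        · exact h'
      · intro i _
        rw [ih (by omega), mul_zero, mul_zero]
        rw [map_add, hk, Finsupp.degree_single]; omega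
  apply MvPowerSeries.nat_le_order
  intro k hk
  rw [coeff_coe]
  exact key (m - k.degree) (by omega) k (by omega)

def TT (m : ℕ) : Finset (Fin 3 →₀ ℕ) :=
  if m = 0 then ∅ else Finset.finsuppAntidiag Finset.univ (m - 1)

lemma card_TT (m : ℕ) : (TT m).card = (m + 1).choose 2 := by
  rcases m with _ | m
  · simp [TT]
  · simp [TT, card_anti]

lemma fact1 {ι : Type} [Fintype ι] (v : ι → Fin 3 → ℂ) (t : ℕ) (c : ι → ℕ)
    (hc : ∀ i, c i ≤ t + 1) :
    Module.finrank ℂ (SS t) ≤ Module.finrank ℂ (LS v t c) + ∑ i, (c i + 1).choose 2 := by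
  let Φ : SS t →ₗ[ℂ] ((Σ i : ι, (TT (c i))) → ℂ) :=
    LinearMap.pi (fun k => (lcoeff ℂ k.2.1).comp ((tr (v k.1)).toLinearMap.comp (SS t).subtype))
  have h1 := LinearMap.finrank_range_add_finrank_ker Φ
  have h2 : Module.finrank ℂ (LinearMap.range Φ) ≤ ∑ i, (c i + 1).choose 2 := by
    refine (Submodule.finrank_le _).trans ?_
    rw [Module.finrank_fintype_fun_eq_card, Fintype.card_sigma]
    simp [card_TT]
  have h3 : Module.finrank ℂ (LinearMap.ker Φ) ≤ Module.finrank ℂ (LS v t c) := by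
    rw [(Submodule.equivMapOfInjective (SS t).subtype (Submodule.subtype_injective _)
      (LinearMap.ker Φ)).finrank_eq]
    apply Submodule.finrank_mono
    rintro _ ⟨⟨A, hA⟩, hk, rfl⟩
    refine ⟨hA, fun i => ?_⟩
    rcases hm : c i with _ | m
    · simp
    · apply od_ge_of_top hA (by have := hc i; omega)
      intro k hk'
      have hmem : k ∈ TT (c i) := by
        rw [hm]; simp only [TT]; rw [if_neg (by omega), mem_anti]; simpa using hk'
      have := congrFun hk ⟨i, ⟨k, hmem⟩⟩
      simpa [Φ] using this
  omega

lemma od_dvd {v : Fin 3 → ℂ} {F G : MvPolynomial (Fin 3) ℂ} (h : F ∣ G) : od v F ≤ od v G := by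
  obtain ⟨H, rfl⟩ := h
  rw [od_mul]; exact le_self_add

lemma od_pow_ge {v : Fin 3 → ℂ} {F : MvPolynomial (Fin 3) ℂ} (h : eval v F = 0) (n : ℕ) :
    (n : ℕ∞) ≤ od v (F ^ n) := by
  induction n with
  | zero => simp
  | succ n ih =>
    rw [pow_succ, od_mul]; push_cast
    exact add_le_add ih ((one_le_od _ _).2 h)

def PtSep {ι : Type} (v : ι → Fin 3 → ℂ) : Prop :=
  (∀ i, ∃ l : MvPolynomial (Fin 3) ℂ, l.IsHomogeneous 1 ∧ eval (v i) l ≠ 0) ∧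
  ∀ i j, j ≠ i → ∃ l : MvPolynomial (Fin 3) ℂ, l.IsHomogeneous 1 ∧ eval (v i) l ≠ 0 ∧
    eval (v j) l = 0

lemma exists_R {ι : Type} [Fintype ι] [DecidableEq ι] {v : ι → Fin 3 → ℂ} (hv : PtSep v) (i : ι)
    (c : ι → ℕ) : ∃ t0, ∀ t, t0 ≤ t → ∃ R : MvPolynomial (Fin 3) ℂ, R.IsHomogeneous t ∧
      eval (v i) R ≠ 0 ∧ ∀ j, j ≠ i → (c j : ℕ∞) ≤ od (v j) R := by
  obtain ⟨μ, hμ, hμ0⟩ := hv.1 i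
  choose! l hl hl0 hl1 using hv.2 i
  refine ⟨∑ j ∈ Finset.univ.erase i, 1 * c j, fun t ht =>
    ⟨(∏ j ∈ Finset.univ.erase i, l j ^ c j) * μ ^ (t - ∑ j ∈ Finset.univ.erase i, 1 * c j),
      ?_, ?_, ?_⟩⟩
  · have h1 : (∏ j ∈ Finset.univ.erase i, l j ^ c j).IsHomogeneous
        (∑ j ∈ Finset.univ.erase i, 1 * c j) :=
      IsHomogeneous.prod _ _ _ fun j hj => (hl j (Finset.ne_of_mem_erase hj)).pow _
    convert h1.mul (hμ.pow (t - ∑ j ∈ Finset.univ.erase i, 1 * c j)) using 1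
    omega
  · rw [map_mul, map_pow, map_prod]
    refine mul_ne_zero (Finset.prod_ne_zero_iff.2 fun j hj => ?_) (pow_ne_zero _ hμ0)
    rw [map_pow]
    exact pow_ne_zero _ (hl0 j (Finset.ne_of_mem_erase hj))
  · intro j hj
    refine (od_pow_ge (hl1 j hj) (c j)).trans (od_dvd (Dvd.dvd.mul_right ?_ _))
    exact Finset.dvd_prod_of_mem (fun j => l j ^ c j) (by simp [hj])

lemma fact2 {ι : Type} [Fintype ι] [DecidableEq ι] {v : ι → Fin 3 → ℂ} (hv : PtSep v) (N : ℕ) :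
    ∀ c : ι → ℕ, ∑ i, c i = N → ∃ t0, ∀ t, t0 ≤ t →
      Module.finrank ℂ (LS v t c) + ∑ i, (c i + 1).choose 2 ≤ Module.finrank ℂ (SS t) := by
  induction N with
  | zero =>
    intro c hc
    have hc' : ∀ i, c i = 0 := fun i => (Finset.sum_eq_zero_iff.1 hc) i (Finset.mem_univ i)
    refine ⟨0, fun t _ => ?_⟩
    simp only [hc', zero_add]
    simpa using Submodule.finrank_mono (LS_le v t c)
  | succ N ih =>
    intro c hc
    obtain ⟨i, hi⟩ : ∃ i, c i ≠ 0 := by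
      by_contra! h
      simp [h] at hc
    obtain ⟨m, hm⟩ := Nat.exists_eq_succ_of_ne_zero hi
    rw [Nat.succ_eq_add_one] at hm
    have hsplit : ∀ (f : ι → ℕ), ∑ j, f j = f i + ∑ j ∈ Finset.univ.erase i, f j := fun f =>
      (Finset.add_sum_erase _ _ (Finset.mem_univ i)).symm
    have hother : ∀ (g : ℕ → ℕ), ∑ j ∈ Finset.univ.erase i, g (Function.update c i m j) =
        ∑ j ∈ Finset.univ.erase i, g (c j) := fun g =>
      Finset.sum_congr rfl fun j hj => by
        rw [Function.update_of_ne (Finset.ne_of_mem_erase hj)]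
    obtain ⟨t0, ht0⟩ := ih (Function.update c i m) (by
      have h1 := hsplit (Function.update c i m)
      have h2 := hsplit c
      have h3 := hother id
      simp only [id, Function.update_self] at h1 h3
      omega)
    obtain ⟨t1, ht1⟩ := exists_R hv i c
    refine ⟨t0 + t1 + m, fun t ht => ?_⟩
    obtain ⟨R, hR, hR0, hR1⟩ := ht1 (t - m) (by omega)
    have h0 := ht0 t (by omega)
    have hodR : od (v i) R = 0 := by
      by_contra h
      exact hR0 ((one_le_od _ _).1 (Order.one_le_iff_ne_zero.2 h))
    have hRne : R ≠ 0 := by rintro rfl; simp at hR0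
    let D := LS (fun _ : Unit => v i) m (fun _ => m)
    have hD := fact1 (fun _ : Unit => v i) m (fun _ => m) (fun _ => by omega)
    let U := D.map (LinearMap.mulLeft ℂ R)
    have hU : Module.finrank ℂ U = Module.finrank ℂ D :=
      (Submodule.equivMapOfInjective (LinearMap.mulLeft ℂ R)
        (mul_right_injective₀ hRne) D).finrank_eq.symm
    have hinf : U ⊓ LS v t c = ⊥ := by
      rw [eq_bot_iff]
      rintro _ ⟨⟨Q, hQ, rfl⟩, h2⟩
      rw [LinearMap.mulLeft_apply] at h2 ⊢
      by_contra hne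
      have hQ0 : Q ≠ 0 := by rintro rfl; simp at hne
      have h3 := h2.2 i
      rw [od_mul, hodR, zero_add, hm] at h3
      have h4 := h3.trans (od_le hQ.1 hQ0)
      rw [Nat.cast_le] at h4
      omega
    have hsup : U ⊔ LS v t c ≤ LS v t (Function.update c i m) := by
      apply sup_le
      · rintro _ ⟨Q, hQ, rfl⟩
        rw [LinearMap.mulLeft_apply]
        refine ⟨?_, fun j => ?_⟩
        · convert hR.mul hQ.1 using 1; omega
        · rw [od_mul]
          by_cases hj : j = i
          · subst hj
            rw [Function.update_self]
            exact (hQ.2 ()).trans le_add_self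
          · rw [Function.update_of_ne hj]
            exact (hR1 j hj).trans le_self_add
      · intro A hA
        refine ⟨hA.1, fun j => le_trans ?_ (hA.2 j)⟩
        by_cases hj : j = i
        · subst hj
          rw [Function.update_self, hm]; simp
        · rw [Function.update_of_ne hj]
    have h5 := Submodule.finrank_sup_add_finrank_inf_eq U (LS v t c)
    rw [hinf, finrank_bot] at h5
    have h6 := Submodule.finrank_mono hsup
    have h7 := hsplit (fun j => (c j + 1).choose 2)
    have h8 := hsplit (fun j => (Function.update c i m j + 1).choose 2)
    have h9 := hother (fun x => (x + 1).choose 2)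
    simp only [Function.update_self] at h8 h9
    simp only [hm] at h7
    rw [finrank_SS] at hD
    simp only [Finset.univ_unique, Finset.sum_const, Finset.card_singleton, one_smul] at hD
    have h10 : (m + 1 + 1).choose 2 = (m + 1) + (m + 1).choose 2 := by
      rw [Nat.choose_succ_succ' (m + 1) 1, Nat.choose_one_right]
    change (m + 1 + 1).choose 2 ≤ Module.finrank ℂ D + _ at hD
    omega

theorem bezout {ι : Type} [Fintype ι] [DecidableEq ι] {v : ι → Fin 3 → ℂ} (hv : PtSep v)
    {F G : MvPolynomial (Fin 3) ℂ} {d e : ℕ} (hF : F.IsHomogeneous d) (hG : G.IsHomogeneous e)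
    (hirr : Irreducible F) (hFG : ¬ F ∣ G) (a b : ι → ℕ) (ha : ∀ i, (a i : ℕ∞) ≤ od (v i) F)
    (hb : ∀ i, (b i : ℕ∞) ≤ od (v i) G) : ∑ i, a i * b i ≤ d * e := by
  obtain ⟨t0, ht0⟩ := fact2 hv _ (fun i => a i + b i) rfl
  let s := t0 + ∑ i, a i + ∑ i, b i
  have hsa : ∀ i, a i ≤ s := fun i => by
    have := Finset.single_le_sum (f := a) (fun i _ => Nat.zero_le _) (Finset.mem_univ i); omega
  have hsb : ∀ i, b i ≤ s := fun i => by
    have := Finset.single_le_sum (f := b) (fun i _ => Nat.zero_le _) (Finset.mem_univ i); omega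
  have h0 := ht0 (d + e + s) (by omega)
  have hA := fact1 v (e + s) b (fun i => by have := hsb i; omega)
  have hB := fact1 v (d + s) a (fun i => by have := hsa i; omega)
  have hF0 := hirr.ne_zero
  have hprime : Prime F := hirr.prime
  let φ : (LS v (e + s) b × LS v (d + s) a) →ₗ[ℂ] MvPolynomial (Fin 3) ℂ :=
    ((LinearMap.mulLeft ℂ F).comp (LS v (e + s) b).subtype).coprod
      ((LinearMap.mulLeft ℂ G).comp (LS v (d + s) a).subtype)
  have hφ : ∀ x, φ x = F * x.1.1 + G * x.2.1 := fun x => by simp [φ]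
  have hrn := LinearMap.finrank_range_add_finrank_ker φ
  rw [Module.finrank_prod] at hrn
  have hrange : LinearMap.range φ ≤ LS v (d + e + s) (fun i => a i + b i) := by
    rintro _ ⟨⟨⟨A, hA⟩, ⟨B, hB⟩⟩, rfl⟩
    rw [hφ]
    apply Submodule.add_mem
    · refine ⟨?_, fun i => ?_⟩
      · convert hF.mul hA.1 using 1; omega
      · rw [od_mul]; push_cast; exact add_le_add (ha i) (hA.2 i)
    · refine ⟨?_, fun i => ?_⟩
      · convert hG.mul hB.1 using 1; omega
      · rw [od_mul, add_comm]; push_cast; exact add_le_add (hB.2 i) (hb i)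
  have h1 := Submodule.finrank_mono hrange
  have h2 : Module.finrank ℂ (LinearMap.ker φ) ≤ Module.finrank ℂ (SS s) := by
    let ψ : LinearMap.ker φ →ₗ[ℂ] MvPolynomial (Fin 3) ℂ :=
      (LS v (d + s) a).subtype.comp ((LinearMap.snd ℂ _ _).comp (LinearMap.ker φ).subtype)
    have hψ : Function.Injective ψ := by
      rw [injective_iff_map_eq_zero]
      rintro ⟨⟨A, B⟩, hk⟩ h
      have hB0 : B.1 = 0 := h
      have hk' := LinearMap.mem_ker.1 hk
      rw [hφ] at hk'
      simp only [hB0, mul_zero, add_zero, mul_eq_zero, hF0, false_or] at hk'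
      have : A = 0 := Subtype.ext hk'
      have : B = 0 := Subtype.ext hB0
      simp [*]
    rw [← LinearMap.finrank_range_of_inj hψ]
    refine le_trans (Submodule.finrank_mono (t := (SS s).map (LinearMap.mulLeft ℂ F)) ?_)
      (Submodule.finrank_map_le _ _)
    rintro _ ⟨⟨⟨A, B⟩, hk⟩, rfl⟩
    have hk' := LinearMap.mem_ker.1 hk
    rw [hφ] at hk'
    simp only at hk'
    have hdvd : F ∣ G * B.1 := ⟨-A.1, by linear_combination hk'⟩
    obtain ⟨B', hB'⟩ := (hprime.dvd_or_dvd hdvd).resolve_left hFG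
    refine ⟨B', ?_, hB'.symm⟩
    by_cases hz : B' = 0
    · rw [hz]; exact Submodule.zero_mem _
    have hBh : (B' * F).IsHomogeneous (d + s) := by rw [mul_comm, ← hB']; exact B.2.1
    have hne : B' * F ≠ 0 := mul_ne_zero hz hF0
    have h3 := isHomogeneous_of_mul hBh hne
    have h4 := (h3.mul hF).inj_right hBh hne
    have h5 : B'.totalDegree = s := by omega
    rw [h5] at h3
    exact h3
  rw [finrank_SS] at *
  have hsum : ∑ i, (a i + b i + 1).choose 2 =
      ∑ i, (a i + 1).choose 2 + ∑ i, (b i + 1).choose 2 + ∑ i, a i * b i := by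
    rw [← Finset.sum_add_distrib, ← Finset.sum_add_distrib]
    refine Finset.sum_congr rfl fun i _ => ?_
    have h1 := choose2 (a i)
    have h2 := choose2 (b i)
    have h3 := choose2 (a i + b i)
    nlinarith
  have hch : (d + e + s + 2).choose 2 + (s + 2).choose 2 =
      (d + s + 2).choose 2 + (e + s + 2).choose 2 + d * e := by
    have h1 := choose2 (d + e + s + 1)
    have h2 := choose2 (s + 1)
    have h3 := choose2 (d + s + 1)
    have h4 := choose2 (e + s + 1)
    nlinarith
  omega

lemma exists_form (f : Module.Dual ℂ (Fin 3 → ℂ)) : ∃ l : MvPolynomial (Fin 3) ℂ,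
    l.IsHomogeneous 1 ∧ ∀ w, eval w l = f w := by
  refine ⟨∑ j, C (f (Pi.single j 1)) * X j, IsHomogeneous.sum _ _ _ fun j _ =>
    isHomogeneous_C_mul_X _ _, fun w => ?_⟩
  rw [LinearMap.pi_apply_eq_sum_univ f w]
  simp only [map_sum, map_mul, eval_C, eval_X, smul_eq_mul]
  refine Finset.sum_congr rfl fun j _ => ?_
  rw [mul_comm]
  congr 2
  ext i; simp [Pi.single_apply, eq_comm]

lemma sep_of_inj {ι : Type} {p : ι → P2} (hp : Function.Injective p) :
    PtSep (fun i => (p i).rep) := by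
  have key : ∀ (W : Submodule ℂ (Fin 3 → ℂ)) (x : Fin 3 → ℂ), x ∉ W →
      ∃ l : MvPolynomial (Fin 3) ℂ, l.IsHomogeneous 1 ∧ eval x l ≠ 0 ∧ ∀ w ∈ W, eval w l = 0 := by
    intro W x hx
    obtain ⟨f, hf, hW⟩ := Submodule.exists_le_ker_of_notMem hx
    obtain ⟨l, hl, hl'⟩ := exists_form f
    exact ⟨l, hl, by rwa [hl'], fun w hw => by rw [hl']; exact hW hw⟩
  constructor
  · intro i
    obtain ⟨l, h1, h2, _⟩ := key ⊥ (p i).rep (by simpa using (p i).rep_nonzero)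
    exact ⟨l, h1, h2⟩
  · intro i j hij
    obtain ⟨l, h1, h2, h3⟩ := key (Submodule.span ℂ {(p j).rep}) (p i).rep (by
      intro h
      rw [Submodule.mem_span_singleton] at h
      apply hij
      apply hp
      rw [← (p i).mk_rep, ← (p j).mk_rep, eq_comm, Projectivization.mk_eq_mk_iff']
      exact h)
    exact ⟨l, h1, h2, h3 _ (Submodule.mem_span_singleton_self _)⟩

lemma pMult_mul {F G : MvPolynomial (Fin 3) ℂ} (hF : F ≠ 0) (hG : G ≠ 0) (q : P2) :
    pMult (F * G) q = pMult F q + pMult G q := by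
  have : (pMult (F * G) q : ℕ∞) = pMult F q + pMult G q := by
    rw [pMult_eq (mul_ne_zero hF hG), pMult_eq hF, pMult_eq hG, od_mul]
  exact_mod_cast this

lemma pMult_pos {F : MvPolynomial (Fin 3) ℂ} (hF : F ≠ 0) (q : P2) :
    1 ≤ pMult F q ↔ pVanish F q := by
  rw [pVanish, ← one_le_od, ← pMult_eq hF]
  norm_cast

lemma pMult_ge {F : MvPolynomial (Fin 3) ℂ} (hF : F ≠ 0) (q : P2) (m : ℕ) :
    m ≤ pMult F q ↔ pHasMultGE F q m := by
  rw [pHasMultGE, hasMultGE_iff, ← pMult_eq hF]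
  norm_cast

lemma pMult_le {F : MvPolynomial (Fin 3) ℂ} (hF : F ≠ 0) (q : P2) {d : ℕ}
    (hd : F.IsHomogeneous d) : pMult F q ≤ d := by
  have := od_le (v := q.rep) hd hF
  rw [← pMult_eq hF] at this
  exact_mod_cast this

lemma exG {ι : Type} [Fintype ι] (p : ι → P2) (e : ℕ) (b : ι → ℕ)
    (hb : ∀ i, b i ≤ e + 1) (hs : ∑ i, (b i + 1).choose 2 < (e + 2).choose 2) :
    ∃ G : MvPolynomial (Fin 3) ℂ, G ≠ 0 ∧ G.IsHomogeneous e ∧ ∀ i, b i ≤ pMult G (p i) := by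
  have h := fact1 (fun i => (p i).rep) e b hb
  rw [finrank_SS] at h
  have hne : LS (fun i => (p i).rep) e b ≠ ⊥ := by
    intro h0
    rw [h0, finrank_bot] at h
    omega
  obtain ⟨G, hG, hG0⟩ := Submodule.exists_mem_ne_zero_of_ne_bot hne
  refine ⟨G, hG0, hG.1, fun i => ?_⟩
  rw [pMult_ge hG0, pHasMultGE, hasMultGE_iff]
  exact hG.2 i

lemma deg_le_of_dvd {F G : MvPolynomial (Fin 3) ℂ} {d e : ℕ} (hF : F.IsHomogeneous d)
    (hG : G.IsHomogeneous e) (hG0 : G ≠ 0) (h : F ∣ G) : d ≤ e := by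
  have hF0 : F ≠ 0 := fun h0 => hG0 (by rw [h0] at h; exact zero_dvd_iff.1 h)
  have := totalDegree_le_of_dvd_of_isDomain h hG0
  rwa [hF.totalDegree hF0, hG.totalDegree hG0] at this

lemma dich {ι : Type} [Fintype ι] {p : ι → P2} (hp : Function.Injective p)
    {F : MvPolynomial (Fin 3) ℂ} {d : ℕ} (hF : F.IsHomogeneous d) (hirr : Irreducible F)
    (e : ℕ) (b : ι → ℕ)
    (hb : ∀ i, b i ≤ e + 1) (hs : ∑ i, (b i + 1).choose 2 < (e + 2).choose 2) :
    d ≤ e ∨ ∑ i, pMult F (p i) * b i ≤ d * e := by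
  classical
  obtain ⟨G, hG0, hG, hGb⟩ := exG p e b hb hs
  by_cases h : F ∣ G
  · exact Or.inl (deg_le_of_dvd hF hG hG0 h)
  · right
    refine bezout (sep_of_inj hp) hF hG hirr h _ b (fun i => (pMult_eq hirr.ne_zero _).le)
      fun i => ?_
    rw [← pMult_eq hG0]
    exact_mod_cast hGb i

lemma deg_pos {F : MvPolynomial (Fin 3) ℂ} {d : ℕ} (hF : F.IsHomogeneous d)
    (hirr : Irreducible F) : 1 ≤ d := by
  rcases Nat.eq_zero_or_pos d with rfl | h
  · exfalso
    have h1 := hF.totalDegree_le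
    rw [Nat.le_zero, totalDegree_eq_zero_iff_eq_C] at h1
    apply hirr.not_isUnit
    have h0 := hirr.ne_zero
    rw [h1] at h0 ⊢
    exact (isUnit_iff_ne_zero.2 fun h => h0 (by rw [h, C_0])).map C
  · exact h

lemma pair_le {ι : Type} {p : ι → P2} (hp : Function.Injective p)
    {F : MvPolynomial (Fin 3) ℂ} {d : ℕ} (hF : F.IsHomogeneous d) (hirr : Irreducible F)
    (hd : 2 ≤ d) {a b : ι} (hab : a ≠ b) : pMult F (p a) + pMult F (p b) ≤ d := by
  have hinj : Function.Injective ![p a, p b] := by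
    intro i j h
    have := hp.ne hab
    fin_cases i <;> fin_cases j <;> simp_all
  rcases dich hinj hF hirr 1 (fun _ => 1) (by simp) (by decide) with h | h
  · omega
  · simpa using h

lemma eval_smul_hom_s4 {F : MvPolynomial (Fin 3) ℂ} {d : ℕ} (hF : F.IsHomogeneous d) (r : ℂ)
    (w : Fin 3 → ℂ) : eval (r • w) F = r ^ d * eval w F := by
  rw [eval_eq, eval_eq, Finset.mul_sum]
  refine Finset.sum_congr rfl fun k hk => ?_
  have hd : ∑ i, k i = d := by
    have := hF.degree_eq_sum_deg_support hk
    rw [this]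
    exact (Finset.sum_subset (Finset.subset_univ _) (by simp)).symm
  simp only [Pi.smul_apply, smul_eq_mul, mul_pow, Finset.prod_mul_distrib, Finset.prod_pow_eq_pow_sum]
  have h2 : ∏ i ∈ k.support, r ^ k i = r ^ d := by
    rw [Finset.prod_pow_eq_pow_sum, ← hd]
    congr 1
    exact Finset.sum_subset (Finset.subset_univ _) (by simp)
  have h3 : r ^ (∑ i ∈ k.support, k i) = r ^ d := by rw [← Finset.prod_pow_eq_pow_sum, h2]
  rw [h3]; ring

lemma exists_zero {F : MvPolynomial (Fin 3) ℂ} {d : ℕ} (hF : F.IsHomogeneous d) (hd : 1 ≤ d)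
    (u w : Fin 3 → ℂ) : eval w F = 0 ∨ ∃ s : ℂ, eval (u + s • w) F = 0 := by
  let q (a b : Fin 3 → ℂ) : Polynomial ℂ := aeval (fun i => Polynomial.C (a i) + Polynomial.X * Polynomial.C (b i)) F
  have hq : ∀ a b s, (q a b).eval s = eval (a + s • b) F := by
    intro a b s
    have : ((Polynomial.evalRingHom s).comp (aeval (fun i => Polynomial.C (a i) + Polynomial.X * Polynomial.C (b i)) : MvPolynomial (Fin 3) ℂ →ₐ[ℂ] Polynomial ℂ).toRingHom) = eval (a + s • b) := by
      apply MvPolynomial.ringHom_ext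
      · intro r; simp
      · intro i; simp; ring
    exact DFunLike.congr_fun this F
  by_contra! hcon
  obtain ⟨h1, h2⟩ := hcon
  have hdeg : (q u w).degree = 0 := by
    by_contra h
    obtain ⟨s, hs⟩ := IsAlgClosed.exists_root (q u w) h
    exact h2 s (by rw [← hq]; exact hs)
  set c := (q u w).coeff 0
  have hc : ∀ s : ℂ, eval (u + s • w) F = c := by
    intro s
    have := hq u w s
    rw [Polynomial.eq_C_of_degree_eq_zero hdeg] at this
    simpa using this.symm
  have hpoly : q w u = Polynomial.C c * Polynomial.X ^ d := by
    apply Polynomial.eq_of_infinite_eval_eq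
    refine Set.Infinite.mono (s := {0}ᶜ) ?_ (Set.finite_singleton (0 : ℂ)).infinite_compl
    intro r hr
    have hr' : r ≠ 0 := hr
    simp only [Set.mem_ofPred_eq, hq]
    have : w + r • u = r • (u + r⁻¹ • w) := by
      rw [smul_add, smul_smul, mul_inv_cancel₀ hr', one_smul, add_comm]
    rw [this, eval_smul_hom_s4 hF, hc]
    simp only [Polynomial.eval_mul, Polynomial.eval_C, Polynomial.eval_pow, Polynomial.eval_X]
    ring
  have := hq w u 0
  rw [hpoly] at this
  apply h1
  simpa [show d ≠ 0 by omega] using this.symm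

lemma exists_extra {F : MvPolynomial (Fin 3) ℂ} {d : ℕ} (hF : F.IsHomogeneous d) (hd : 1 ≤ d)
    (p : Fin 8 → P2) : ∃ y : P2, pVanish F y ∧ ∀ i, y ≠ p i := by
  obtain ⟨f, hf⟩ := Module.exists_dual_forall_apply_ne_zero (K := ℂ) (fun i => (p i).rep)
    (fun i => (p i).rep_nonzero)
  have key : ∀ z : Fin 3 → ℂ, z ≠ 0 → f z = 0 → eval z F = 0 →
      ∃ y : P2, pVanish F y ∧ ∀ i, y ≠ p i := by
    intro z hz hfz hFz
    obtain ⟨a, ha⟩ := Projectivization.exists_smul_eq_mk_rep ℂ z hz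
    have ha' : (a : ℂ) • z = (Projectivization.mk ℂ z hz).rep := ha
    refine ⟨Projectivization.mk ℂ z hz, ?_, fun i hi => hf i ?_⟩
    · rw [pVanish, ← ha', eval_smul_hom_s4 hF, hFz, mul_zero]
    · rw [← hi, ← ha', map_smul, hfz, smul_zero]
  have hk : 1 < Module.finrank ℂ (LinearMap.ker f) := by
    have h1 := LinearMap.finrank_range_add_finrank_ker f
    have h2 := Submodule.finrank_le (LinearMap.range f)
    simp at h1 h2
    omega
  have : Nontrivial (LinearMap.ker f) := Module.nontrivial_of_finrank_pos (R := ℂ) (by omega)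
  obtain ⟨w, hw⟩ := exists_ne (0 : LinearMap.ker f)
  obtain ⟨u, hu⟩ := exists_linearIndependent_pair_of_one_lt_finrank hk hw
  rcases exists_zero hF hd u.1 w.1 with h | ⟨s, h⟩
  · exact key w.1 (by simpa using hw) w.2 h
  · refine key (u.1 + s • w.1) ?_ (by simp) h
    intro h0
    have h1 : s • w + (1 : ℂ) • u = 0 := Subtype.ext (by simpa [add_comm] using h0)
    have := LinearIndependent.pair_iff.1 hu s 1 h1
    simp at this

lemma emb_of_card {s : Finset (Fin 8)} {k : ℕ} (h : k ≤ s.card) :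
    ∃ f : Fin k ↪ Fin 8, ∀ i, f i ∈ s :=
  ⟨(s.orderEmbOfCardLe h).toEmbedding, fun i => s.orderEmbOfCardLe_mem h i⟩

lemma sum_le_card_of {m : Fin 8 → ℕ} (h : ∀ i, m i ≤ 1) :
    ∑ i, m i ≤ (Finset.univ.filter (fun i => 1 ≤ m i)).card := by
  rw [Finset.card_filter]
  refine Finset.sum_le_sum fun i _ => ?_
  have := h i
  split_ifs <;> omega

lemma low_deg {p : Fin 8 → P2} (hp : GenPos p)
    {F : MvPolynomial (Fin 3) ℂ} {d : ℕ} (hF : F.IsHomogeneous d) (hirr : Irreducible F)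
    (hd : d ≤ 3) : ∑ i, pMult F (p i) + 1 ≤ 3 * d := by
  have h1 := deg_pos hF hirr
  have h0 := hirr.ne_zero
  obtain ⟨hinj, hl, hc, hcub⟩ := hp
  have hpair : 2 ≤ d → ∀ a b, a ≠ b → pMult F (p a) + pMult F (p b) ≤ d := fun h2 a b hab =>
    pair_le hinj hF hirr h2 hab
  set m : Fin 8 → ℕ := fun i => pMult F (p i) with hm
  have hle : ∀ i, m i ≤ d := fun i => pMult_le h0 _ hF
  have hbig : ∀ a, 2 ≤ d → ∑ i, m i ≤ m a + 7 * (d - m a) := by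
    intro a h2
    rw [← Finset.add_sum_erase _ _ (Finset.mem_univ a)]
    have : ∑ i ∈ Finset.univ.erase a, m i ≤ _ := Finset.sum_le_card_nsmul (Finset.univ.erase a) m (d - m a) (fun i hi => by
      have : m a + m i ≤ d := hpair h2 a i (Finset.ne_of_mem_erase hi).symm
      omega)
    rw [Finset.card_erase_of_mem (Finset.mem_univ a), Finset.card_univ, Fintype.card_fin,
      smul_eq_mul] at this
    omega
  change ∑ i, m i + 1 ≤ _
  obtain rfl | rfl | rfl : d = 1 ∨ d = 2 ∨ d = 3 := by omega
  · have h := sum_le_card_of hle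
    by_contra hcon
    obtain ⟨f, hf⟩ := emb_of_card (s := Finset.univ.filter (fun i => 1 ≤ m i)) (k := 3) (by omega)
    refine hl f ⟨F, h0, hF, fun k => (pMult_pos h0 _).1 ?_⟩
    simpa using hf k
  · by_cases hall : ∀ i, m i ≤ 1
    · have h := sum_le_card_of hall
      by_contra hcon
      obtain ⟨f, hf⟩ := emb_of_card (s := Finset.univ.filter (fun i => 1 ≤ m i)) (k := 6) (by omega)
      refine hc f ⟨F, h0, hF, fun k => (pMult_pos h0 _).1 ?_⟩
      simpa using hf k
    · push Not at hall
      obtain ⟨a, ha⟩ := hall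
      have := hbig a (by omega)
      have := hle a
      omega
  · by_cases hall : ∀ i, m i ≤ 1
    · have : ∑ i, m i ≤ _ := Finset.sum_le_card_nsmul Finset.univ m 1 (fun i _ => hall i)
      rw [Finset.card_univ, Fintype.card_fin, smul_eq_mul] at this
      omega
    · push Not at hall
      obtain ⟨a, ha⟩ := hall
      obtain ⟨z, hz⟩ : ∃ z, m z = 0 := by
        by_contra! hcon
        refine hcub (Function.Embedding.refl _) ⟨F, h0, hF, fun k => (pMult_pos h0 _).1 ?_,
          a, (pMult_ge h0 _ _).1 ha⟩
        exact Nat.one_le_iff_ne_zero.2 (hcon k)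
      have hza : z ≠ a := by rintro rfl; omega
      rw [← Finset.add_sum_erase _ _ (Finset.mem_univ a),
        ← Finset.add_sum_erase _ _ (Finset.mem_erase.2 ⟨hza, Finset.mem_univ z⟩)]
      have : ∑ i ∈ (Finset.univ.erase a).erase z, m i ≤ _ :=
        Finset.sum_le_card_nsmul ((Finset.univ.erase a).erase z) m (3 - m a) (fun i hi => by
        have : m a + m i ≤ 3 := hpair (by omega) a i
          (Finset.ne_of_mem_erase (Finset.mem_of_mem_erase hi)).symm
        omega)
      have hcard : ((Finset.univ.erase a).erase z).card = 6 := by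
        rw [Finset.card_erase_of_mem (Finset.mem_erase.2 ⟨hza, Finset.mem_univ z⟩),
          Finset.card_erase_of_mem (Finset.mem_univ a)]
        simp
      rw [hcard, smul_eq_mul] at this
      have := hle a
      omega

lemma antiK_pos {p : Fin 8 → P2} (hp : GenPos p)
    {F : MvPolynomial (Fin 3) ℂ} {d : ℕ} (hF : F.IsHomogeneous d) (hirr : Irreducible F) :
    ∑ i, pMult F (p i) + 1 ≤ 3 * d := by
  obtain ⟨y, hy, hyp⟩ := exists_extra hF (deg_pos hF hirr) p
  have hinj : Function.Injective (Fin.cons y p : Fin 9 → P2) :=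
    Fin.cons_injective_iff.2 ⟨fun ⟨i, hi⟩ => hyp i hi.symm, hp.1⟩
  rcases dich hinj hF hirr 3 (fun _ => 1) (by simp) (by decide) with h | h
  · exact low_deg hp hF hirr h
  · rw [Fin.sum_univ_succ] at h
    simp only [Fin.cons_zero, Fin.cons_succ, mul_one] at h
    have := (pMult_pos hirr.ne_zero y).2 hy
    omega

lemma lower {p : Fin 8 → P2} (hp : GenPos p)
    {F : MvPolynomial (Fin 3) ℂ} {d : ℕ} (hF : F.IsHomogeneous d) (hirr : Irreducible F) :
    pMult F (p 7) + 3 * ∑ i, pMult F (p i) ≤ 9 * d := by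
  have h1 := antiK_pos hp hF hirr
  by_cases h3 : pMult F (p 7) ≤ 3
  · omega
  push Not at h3
  have hd := pMult_le hirr.ne_zero (p 7) hF
  have hpair : ∀ a : Fin 8, a ≠ 7 → pMult F (p a) + pMult F (p 7) ≤ d := fun a ha =>
    pair_le hp.1 hF hirr (by omega) ha
  have q0 := hpair 0 (by decide)
  have q1 := hpair 1 (by decide)
  have q2 := hpair 2 (by decide)
  have q3 := hpair 3 (by decide)
  have q4 := hpair 4 (by decide)
  have q5 := hpair 5 (by decide)
  have q6 := hpair 6 (by decide)
  have c3 := dich hp.1 hF hirr 3 ![1, 1, 1, 1, 1, 1, 0, 2] (by decide) (by decide)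
  have c6 := dich hp.1 hF hirr 6 ![2, 2, 2, 2, 2, 2, 2, 3] (by decide) (by decide)
  rw [Fin.sum_univ_eight] at *
  simp at c3 c6
  omega

lemma upper {p : Fin 8 → P2} (hp : GenPos p) :
    ∃ (F : MvPolynomial (Fin 3) ℂ) (d : ℕ), F.IsHomogeneous d ∧ Irreducible F ∧
      1 ≤ pMult F (p 7) ∧ 9 * d ≤ pMult F (p 7) + 3 * ∑ i, pMult F (p i) := by
  by_contra! hcon
  have hall : ∀ (F : MvPolynomial (Fin 3) ℂ) (d : ℕ), F.IsHomogeneous d → Irreducible F →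
      pMult F (p 7) + 3 * ∑ i, pMult F (p i) + 1 ≤ 9 * d := by
    intro F d hF hirr
    have h1 := antiK_pos hp hF hirr
    have h2 := hcon F d hF hirr
    omega
  have hind : ∀ G : MvPolynomial (Fin 3) ℂ, ∀ d, G ≠ 0 → G.IsHomogeneous d →
      pMult G (p 7) + 3 * ∑ i, pMult G (p i) + (if d = 0 then 0 else 1) ≤ 9 * d := by
    intro G
    induction G using WfDvdMonoid.induction_on_irreducible with
    | zero => intro d h; exact absurd rfl h
    | unit u hu =>
      intro d h0 hd
      have hz : d = 0 := by
        have h1 := hd.totalDegree h0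
        have h2 := totalDegree_le_of_dvd_of_isDomain hu.dvd (one_ne_zero (α := MvPolynomial (Fin 3) ℂ))
        simp at h2
        omega
      subst hz
      have : ∀ q, pMult u q = 0 := fun q => Nat.le_zero.1 (pMult_le h0 q hd)
      simp [this]
    | mul a i ha hi ih =>
      intro d h0 hd
      have hi' := isHomogeneous_of_mul hd h0
      have ha' := isHomogeneous_of_mul (by rwa [mul_comm] at hd : (a * i).IsHomogeneous d)
        (by rwa [mul_comm] at h0)
      have hdeg := (hi'.mul ha').inj_right hd h0
      have h1 := hall i _ hi' hi
      have h2 := ih _ ha ha'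
      simp only [pMult_mul hi.ne_zero ha, Finset.sum_add_distrib]
      split_ifs at h2 ⊢ <;> omega
  obtain ⟨G, hG0, hG, hGb⟩ := exG p 6 ![2, 2, 2, 2, 2, 2, 2, 3] (by decide) (by decide)
  have h := hind G 6 hG0 hG
  have hs := Finset.sum_le_sum (s := Finset.univ) (fun i _ => hGb i)
  have h7 := hGb 7
  simp [Fin.sum_univ_eight] at h hs h7
  omega

/-- Let `X₇` be the blow-up of `ℙ²` at `7` distinct points in general position and let `x`
be a point of `X₇` in general position.  Then the Seshadri constant of the anticanonical
divisor `-K_{X₇}` at `x` equals `4/3`. -/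
theorem seshadri_antiK_blowup_seven_genPos
    (pts : Fin 7 → P2) (hpts : GenPos pts)
    (B : BlowupP2 7 pts) (x : B.X) (hx : B.genPosPt x) :
    B.seshadri x = 4 / 3 := by
  obtain ⟨hxr, hgp⟩ := hx
  set p : Fin 8 → P2 := Fin.snoc pts (B.μ x) with hpdef
  have hp7 : p 7 = B.μ x := Fin.snoc_last (α := fun _ => P2) _ _
  have hsum : ∀ F : MvPolynomial (Fin 3) ℂ, ∑ i, pMult F (p i) =
      ∑ i, pMult F (pts i) + pMult F (B.μ x) := by
    intro F
    rw [Fin.sum_univ_castSucc]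
    simp [hpdef]
    exact congrArg (pMult F) hp7
  have hlow : ∀ C : B.Curve, B.mem x C → (4 : ℝ) / 3 ≤ (B.interK C : ℝ) / (B.mult x C : ℝ) := by
    intro C hC
    have hpos := (B.mult_pos_iff x C).2 hC
    rw [le_div_iff₀ (by exact_mod_cast hpos)]
    rcases B.curve_cases C with ⟨i, rfl⟩ | ⟨d, F, hF, hirr, hd, hE, hm, _⟩
    · exact absurd ⟨i, ((B.mem_exc i x).1 hC).symm⟩ hxr
    · have h1 := lower hgp hF hirr
      rw [hsum, hp7] at h1
      have hk := B.interK_eq C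
      simp only [hE, hd] at hk
      rw [(hm x hxr).2]
      have h2 : 4 * (pMult F (B.μ x) : ℤ) ≤ 3 * B.interK C := by
        rw [hk]; zify at h1; linarith
      have h3 : 4 * (pMult F (B.μ x) : ℝ) ≤ 3 * B.interK C := by exact_mod_cast h2
      linarith
  obtain ⟨F, d, hF, hirr, hF1, hF2⟩ := upper hgp
  rw [hsum, hp7] at hF2
  rw [hp7] at hF1
  obtain ⟨C, hd, hE, hm, _⟩ := B.strict_exists d F hF hirr
  have hmem : B.mem x C := (hm x hxr).1.2 ((pMult_pos hirr.ne_zero _).1 hF1)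
  have hup : (B.interK C : ℝ) / (B.mult x C : ℝ) ≤ 4 / 3 := by
    have hpos := (B.mult_pos_iff x C).2 hmem
    rw [div_le_iff₀ (by exact_mod_cast hpos), (hm x hxr).2]
    have hk := B.interK_eq C
    simp only [hE, hd] at hk
    have h2 : 3 * B.interK C ≤ 4 * (pMult F (B.μ x) : ℤ) := by
      rw [hk]; zify at hF2; linarith
    have h3 : 3 * (B.interK C : ℝ) ≤ 4 * (pMult F (B.μ x) : ℝ) := by exact_mod_cast h2
    linarith
  apply le_antisymm
  · refine le_trans (csInf_le ⟨4 / 3, ?_⟩ ⟨C, hmem, rfl⟩) hup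
    rintro _ ⟨C', hC', rfl⟩
    exact hlow C' hC'
  · refine le_csInf ⟨_, C, hmem, rfl⟩ ?_
    rintro _ ⟨C', hC', rfl⟩
    exact hlow C' hC'
end
end
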